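/- arXiv:2002.00508 — 2 statements merged into one kernel-verified Lean document; each statement's English description precedes it below -/
import Mathlib

section
/- (Comparison principle) Let d = 2 or d = 3, and let f, g : [0,T]×ℝ^{d−1} → ℝ be, respectively, a classical subsolution and a classical supersolution of the d-dimensional Muskat equation with ‖∇_x f‖_{L∞}, ‖∇_x g‖_{L∞} < 1/√(2d−1). If f(0,x) ≤ g(0,x) for all x ∈ ℝ^{d−1}, then f(t,x) ≤ g(t,x) for all (t,x) ∈ [0,T]×ℝ^{d−1}. -/
open MeasureTheory Filter Set
open scoped RealInnerProductSpace Topology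

noncomputable section

/-- The horizontal slice `ℝ²` (the interface variable space for the 3D Muskat problem). -/
abbrev E2 := EuclideanSpace ℝ (Fin 2)

/-- The integrand of the `d`-dimensional Muskat equation:
`(δ_h g(x) − ∇g(x)·h) / (δ_h g(x)² + |h|²)^{d/2}`. -/
def muskatIntegrand (d : ℕ) {n : ℕ} (g : EuclideanSpace ℝ (Fin n) → ℝ)
    (x h : EuclideanSpace ℝ (Fin n)) : ℝ :=
  (g (x + h) - g x - ⟪gradient g x, h⟫) /
    ((g (x + h) - g x) ^ 2 + ‖h‖ ^ 2) ^ ((d : ℝ) / 2)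

/-- Principal value (over symmetric annuli `1/R < ‖h‖ < R` as `R → ∞`) of the integral of `F`. -/
def HasPV {n : ℕ} (F : EuclideanSpace ℝ (Fin n) → ℝ) (I : ℝ) : Prop :=
  Tendsto (fun R : ℝ => ∫ h in {h : EuclideanSpace ℝ (Fin n) | R⁻¹ < ‖h‖ ∧ ‖h‖ < R}, F h)
    atTop (𝓝 I)

/-- Definition 7.1 of the paper: a classical solution (`rel := Eq`), subsolution
(`rel := (· ≤ ·)`) or supersolution (`rel := fun a b => b ≤ a`) of the `d`-dimensional
Muskat equation on `[0,T]`. -/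
structure IsClassicalMuskat (d : ℕ) (T : ℝ) (rel : ℝ → ℝ → Prop)
    (f : ℝ → EuclideanSpace ℝ (Fin (d - 1)) → ℝ) : Prop where
  /-- `f` is `C¹` on `(0,T) × ℝ^{d-1}`. -/
  smooth : ContDiffOn ℝ 1 (fun p : ℝ × EuclideanSpace ℝ (Fin (d - 1)) => f p.1 p.2)
    (Ioo 0 T ×ˢ univ)
  /-- uniform-in-`x` limit at the initial time -/
  limit_zero : TendstoUniformly (fun t x => f t x) (f 0) (𝓝[>] (0 : ℝ))
  /-- uniform-in-`x` limit at the final time -/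
  limit_T : TendstoUniformly (fun t x => f t x) (f T) (𝓝[<] T)
  /-- local uniform differentiability and integrable sublinear growth bounds -/
  local_bounds : ∀ K : Set (ℝ × EuclideanSpace ℝ (Fin (d - 1))), IsCompact K →
    K ⊆ Ioo 0 T ×ˢ univ →
    ∃ ω Ω : ℝ → ℝ, (∀ r, 0 ≤ ω r) ∧ (∀ R, 0 ≤ Ω R) ∧
      (∀ p ∈ K, ∀ r > (0 : ℝ), ∀ h, ‖h‖ ≤ r →
        |f p.1 (p.2 + h) - f p.1 p.2 - ⟪gradient (f p.1) p.2, h⟫| ≤ ω r * r) ∧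
      (∀ p ∈ K, ∀ R > (0 : ℝ), ∀ h, ‖h‖ ≤ R → |f p.1 (p.2 + h) - f p.1 p.2| ≤ Ω R) ∧
      IntegrableOn (fun r => ω r / r) (Ioc 0 1) ∧
      IntegrableOn (fun R => Ω R / R ^ 2) (Ioi 1)
  /-- the Muskat equation (as a principal value), with `rel` relating `∂ₜ f` to the integral -/
  eqn : ∀ t ∈ Ioo 0 T, ∀ x, ∃ I : ℝ,
    HasPV (muskatIntegrand d (f t) x) I ∧ rel (deriv (fun s => f s x) t) I

/-! ### Kernel lemmas -/

lemma mk_pow_half (d : ℕ) (s : ℝ) (hs : 0 < s) : (s ^ 2) ^ ((d : ℝ) / 2) = s ^ d := by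
  rw [← Real.rpow_natCast s 2, ← Real.rpow_mul hs.le]
  have : ((2 : ℕ) : ℝ) * ((d : ℝ) / 2) = (d : ℝ) := by push_cast; ring
  rw [this, Real.rpow_natCast]

lemma mk_base_ge (d : ℕ) (s a : ℝ) (hs : 0 < s) : s ^ d ≤ (a ^ 2 + s ^ 2) ^ ((d : ℝ) / 2) := by
  rw [← mk_pow_half d s hs]
  apply Real.rpow_le_rpow (by positivity) (by nlinarith [sq_nonneg a]) (by positivity)

lemma mk_mono (d : ℕ) (s m P a b : ℝ) (hs : 0 < s) (hm : (2 * (d : ℝ) - 1) * m ^ 2 ≤ 1)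
    (hd : 1 ≤ d)
    (hP : |P| ≤ m * s) (ha : |a| ≤ m * s) (hb : |b| ≤ m * s) (hab : a ≤ b) :
    (a - P) / (a ^ 2 + s ^ 2) ^ ((d : ℝ) / 2) ≤ (b - P) / (b ^ 2 + s ^ 2) ^ ((d : ℝ) / 2) := by
  have hder : ∀ z : ℝ, HasDerivAt (fun z : ℝ => (z - P) / (z ^ 2 + s ^ 2) ^ ((d : ℝ) / 2))
      ((1 * (z ^ 2 + s ^ 2) ^ ((d : ℝ) / 2) -
        (z - P) * (2 * z * ((d : ℝ) / 2) * (z ^ 2 + s ^ 2) ^ ((d : ℝ) / 2 - 1))) /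
        ((z ^ 2 + s ^ 2) ^ ((d : ℝ) / 2)) ^ 2) z := by
    intro z
    have hpos : 0 < z ^ 2 + s ^ 2 := by positivity
    have h1 : HasDerivAt (fun z : ℝ => z ^ 2 + s ^ 2) (2 * z) z := by
      simpa using (hasDerivAt_pow 2 z).add_const (s ^ 2)
    have h2 := h1.rpow_const (p := (d : ℝ) / 2) (Or.inl hpos.ne')
    exact ((hasDerivAt_id z).sub_const P).fun_div h2 (Real.rpow_pos_of_pos hpos _).ne'
  have hmono : MonotoneOn (fun z : ℝ => (z - P) / (z ^ 2 + s ^ 2) ^ ((d : ℝ) / 2))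
      (Icc (-(m * s)) (m * s)) := by
    apply monotoneOn_of_deriv_nonneg (convex_Icc _ _)
    · exact fun z _ => (hder z).continuousAt.continuousWithinAt
    · exact fun z _ => (hder z).differentiableAt.differentiableWithinAt
    · intro z hz
      rw [interior_Icc] at hz
      rw [(hder z).deriv]
      have hpos : 0 < z ^ 2 + s ^ 2 := by positivity
      apply div_nonneg _ (by positivity)
      have e : (z ^ 2 + s ^ 2) ^ ((d : ℝ) / 2) =
          (z ^ 2 + s ^ 2) * (z ^ 2 + s ^ 2) ^ ((d : ℝ) / 2 - 1) := by
        rw [Real.rpow_sub_one hpos.ne']; field_simp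
      rw [e]
      have hq : 0 < (z ^ 2 + s ^ 2) ^ ((d : ℝ) / 2 - 1) := Real.rpow_pos_of_pos hpos _
      have hz' : |z| ≤ m * s := abs_le.2 ⟨hz.1.le, hz.2.le⟩
      have hms : 0 ≤ m * s := (abs_nonneg _).trans hz'
      have h1 : z ^ 2 ≤ (m * s) ^ 2 := by rw [← sq_abs]; gcongr
      have h2 : |z * P| ≤ (m * s) ^ 2 := by
        rw [abs_mul, sq]; gcongr
      have h3 := (abs_le.1 h2).1
      have hd1 : (1 : ℝ) ≤ d := by exact_mod_cast hd
      have key : 0 ≤ (z ^ 2 + s ^ 2) - (z - P) * z * d := by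
        have h4 : ((d : ℝ) - 1) * z ^ 2 ≤ (d - 1) * (m * s) ^ 2 := by gcongr
        have h5 : (d : ℝ) * (z * P) ≥ d * (-(m * s) ^ 2) := by
          have : (0 : ℝ) ≤ d := by linarith
          nlinarith
        have h6 : (2 * (d : ℝ) - 1) * m ^ 2 * s ^ 2 ≤ 1 * s ^ 2 := by gcongr
        nlinarith
      have : 1 * ((z ^ 2 + s ^ 2) * (z ^ 2 + s ^ 2) ^ ((d : ℝ) / 2 - 1)) -
        (z - P) * (2 * z * ((d : ℝ) / 2) * (z ^ 2 + s ^ 2) ^ ((d : ℝ) / 2 - 1)) =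
        ((z ^ 2 + s ^ 2) - (z - P) * z * d) * (z ^ 2 + s ^ 2) ^ ((d : ℝ) / 2 - 1) := by ring
      rw [this]
      positivity
  exact hmono (abs_le.1 ha) (abs_le.1 hb) hab

lemma mk_lip (d : ℕ) (s a b : ℝ) (hs : 0 < s) :
    |1 / (a ^ 2 + s ^ 2) ^ ((d : ℝ) / 2) - 1 / (b ^ 2 + s ^ 2) ^ ((d : ℝ) / 2)| ≤
      d / s ^ (d + 1) * |a - b| := by
  have hder : ∀ z : ℝ, HasDerivAt (fun z : ℝ => 1 / (z ^ 2 + s ^ 2) ^ ((d : ℝ) / 2))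
      (2 * z * (-((d : ℝ) / 2)) * (z ^ 2 + s ^ 2) ^ (-((d : ℝ) / 2) - 1)) z := by
    intro z
    have hpos : 0 < z ^ 2 + s ^ 2 := by positivity
    have h1 : HasDerivAt (fun z : ℝ => z ^ 2 + s ^ 2) (2 * z) z := by
      simpa using (hasDerivAt_pow 2 z).add_const (s ^ 2)
    have h2 := h1.rpow_const (p := -((d : ℝ) / 2)) (Or.inl hpos.ne')
    refine h2.congr_of_eventuallyEq (Eventually.of_forall fun w => ?_)
    simp only [one_div]
    rw [Real.rpow_neg (by positivity)]
  have := convex_univ.norm_image_sub_le_of_norm_hasDerivWithin_le (s := (univ : Set ℝ))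
    (f := fun z : ℝ => 1 / (z ^ 2 + s ^ 2) ^ ((d : ℝ) / 2)) (C := d / s ^ (d + 1)) (x := b) (y := a)
    (fun z _ => (hder z).hasDerivWithinAt) ?_ (mem_univ _) (mem_univ _)
  · simpa [Real.norm_eq_abs] using this
  · intro z _
    have hpos : 0 < z ^ 2 + s ^ 2 := by positivity
    have hq : 0 < (z ^ 2 + s ^ 2) ^ (-((d : ℝ) / 2) - 1) := Real.rpow_pos_of_pos hpos _
    rw [Real.norm_eq_abs, abs_mul, abs_of_pos hq, abs_mul, abs_mul, abs_neg, abs_two,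
      abs_of_nonneg (by positivity : (0 : ℝ) ≤ d / 2)]
    have hz : |z| ≤ (z ^ 2 + s ^ 2) ^ ((1 : ℝ) / 2) := by
      rw [← Real.sqrt_eq_rpow]
      exact Real.abs_le_sqrt (by nlinarith [sq_nonneg s])
    have e1 : (z ^ 2 + s ^ 2) ^ ((1 : ℝ) / 2) * (z ^ 2 + s ^ 2) ^ (-((d : ℝ) / 2) - 1) =
        1 / (z ^ 2 + s ^ 2) ^ (((d + 1 : ℕ) : ℝ) / 2) := by
      rw [← Real.rpow_add hpos, one_div ((z ^ 2 + s ^ 2) ^ _), ← Real.rpow_neg hpos.le]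
      congr 1; push_cast; ring
    have e2 : 1 / (z ^ 2 + s ^ 2) ^ (((d + 1 : ℕ) : ℝ) / 2) ≤ 1 / s ^ (d + 1) :=
      one_div_le_one_div_of_le (by positivity) (mk_base_ge (d + 1) s z hs)
    calc 2 * |z| * ((d : ℝ) / 2) * (z ^ 2 + s ^ 2) ^ (-((d : ℝ) / 2) - 1)
        = d * (|z| * (z ^ 2 + s ^ 2) ^ (-((d : ℝ) / 2) - 1)) := by ring
      _ ≤ d * ((z ^ 2 + s ^ 2) ^ ((1 : ℝ) / 2) * (z ^ 2 + s ^ 2) ^ (-((d : ℝ) / 2) - 1)) := by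
          gcongr
      _ ≤ d * (1 / s ^ (d + 1)) := by rw [e1]; gcongr
      _ = _ := by ring

/-- The pointwise comparison at a doubled maximum. -/
lemma mk_pointwise (d : ℕ) (hd : 1 ≤ d) (s m P Q a b ps lam ε : ℝ) (hs : 0 < s)
    (hm : (2 * (d : ℝ) - 1) * m ^ 2 ≤ 1) (hlam : 0 ≤ lam) (hε : 0 < ε)
    (hP : |P| ≤ (m - 2 * lam) * s) (hPQ : |P + lam * Q| ≤ (m - 2 * lam) * s)
    (ha : |a| ≤ (m - 2 * lam) * s)
    (hb : |b| ≤ (m - 2 * lam) * s) (hps : |ps| ≤ s) (hpsQ : ps - Q ≤ s ^ 2 / 2)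
    (h1 : a ≤ b + lam * ps) (h2 : a ≤ P + s ^ 2 / (2 * ε) + lam * ps)
    (h3 : P - s ^ 2 / (2 * ε) ≤ b) :
    (a - (P + lam * Q)) / (a ^ 2 + s ^ 2) ^ ((d : ℝ) / 2)
      - (b - P) / (b ^ 2 + s ^ 2) ^ ((d : ℝ) / 2) ≤
      lam * (d / (2 * ε) + 1 / 2) * (s ^ 2 / s ^ d) := by
  have hls : |lam * ps| ≤ lam * s := by rw [abs_mul, abs_of_nonneg hlam]; gcongr
  have hls0 : 0 ≤ lam * s := by positivity
  obtain ⟨A, hA⟩ : ∃ A, A = max (a - lam * ps) (P - s ^ 2 / (2 * ε)) := ⟨_, rfl⟩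
  have hA1 : a - lam * ps ≤ A := hA ▸ le_max_left _ _
  have hA2 : P - s ^ 2 / (2 * ε) ≤ A := hA ▸ le_max_right _ _
  have hAb : A ≤ b := by rw [hA]; exact max_le (by linarith) h3
  have hAP : |A - P| ≤ s ^ 2 / (2 * ε) := by
    rw [abs_le]; constructor
    · linarith
    · have : A ≤ P + s ^ 2 / (2 * ε) := by
        rw [hA]; apply max_le (by linarith)
        have : 0 ≤ s ^ 2 / (2 * ε) := by positivity
        linarith
      linarith
  have hexp : (m - 2 * lam) * s = m * s - 2 * (lam * s) := by ring
  rw [hexp] at ha hb hP hPQ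
  rw [abs_le] at hls ha hb hP hPQ
  obtain ⟨hls1, hls2⟩ := hls
  obtain ⟨ha1, ha2⟩ := ha
  obtain ⟨hb1, hb2⟩ := hb
  obtain ⟨hP1, hP2⟩ := hP
  obtain ⟨hPQ1, hPQ2⟩ := hPQ
  have hAm : |A| ≤ m * s := by rw [abs_le]; constructor <;> linarith
  have hAm' : |A + lam * ps| ≤ m * s := by rw [abs_le]; constructor <;> linarith
  have k1 := mk_mono d s m (P + lam * Q) a (A + lam * ps) hs hm hd
    (by rw [abs_le]; constructor <;> linarith) (by rw [abs_le]; constructor <;> linarith) hAm'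
    (by linarith)
  have k2 := mk_mono d s m P A b hs hm hd
    (by rw [abs_le]; constructor <;> linarith) hAm (by rw [abs_le]; constructor <;> linarith) hAb
  have k3 := mk_lip d s (A + lam * ps) A hs
  have hbase := mk_base_ge d s (A + lam * ps) hs
  set D1 := ((A + lam * ps) ^ 2 + s ^ 2) ^ ((d : ℝ) / 2) with hD1
  set D0 := (A ^ 2 + s ^ 2) ^ ((d : ℝ) / 2) with hD0
  have hsd : 0 < s ^ d := by positivity
  have hD1pos : 0 < D1 := hsd.trans_le hbase
  have e : (A + lam * ps - (P + lam * Q)) / D1 - (A - P) / D0 =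
      (A - P) * (1 / D1 - 1 / D0) + lam * (ps - Q) * (1 / D1) := by ring
  have t1 : (A - P) * (1 / D1 - 1 / D0) ≤ s ^ 2 / (2 * ε) * (d / s ^ (d + 1) * (lam * s)) := by
    calc (A - P) * (1 / D1 - 1 / D0) ≤ |(A - P) * (1 / D1 - 1 / D0)| := le_abs_self _
      _ = |A - P| * |1 / D1 - 1 / D0| := abs_mul _ _
      _ ≤ _ := by
        gcongr
        refine k3.trans ?_
        gcongr
        rw [abs_le]; constructor <;> linarith
  have t2 : lam * (ps - Q) * (1 / D1) ≤ lam * (s ^ 2 / 2) * (1 / s ^ d) := by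
    gcongr
  have e2 : s ^ 2 / (2 * ε) * (d / s ^ (d + 1) * (lam * s)) + lam * (s ^ 2 / 2) * (1 / s ^ d) =
    lam * (d / (2 * ε) + 1 / 2) * (s ^ 2 / s ^ d) := by
    field_simp
    ring
  linarith

/-! ### The weight -/

/-- the weight `√(1+|x|²)` -/
def mkW {n : ℕ} (x : EuclideanSpace ℝ (Fin n)) : ℝ := Real.sqrt (1 + ‖x‖ ^ 2)

lemma mkW_sq {n : ℕ} (x : EuclideanSpace ℝ (Fin n)) : mkW x ^ 2 = 1 + ‖x‖ ^ 2 :=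
  Real.sq_sqrt (by positivity)

lemma mkW_one_le {n : ℕ} (x : EuclideanSpace ℝ (Fin n)) : 1 ≤ mkW x := by
  rw [mkW, Real.one_le_sqrt]; nlinarith [sq_nonneg ‖x‖]

lemma mkW_norm_le {n : ℕ} (x : EuclideanSpace ℝ (Fin n)) : ‖x‖ ≤ mkW x :=
  Real.le_sqrt_of_sq_le (by linarith)

lemma mkW_add_le {n : ℕ} (x h : EuclideanSpace ℝ (Fin n)) : mkW (x + h) ≤ mkW x + ‖h‖ := by
  have h0 := mkW_one_le x
  have h1 := mkW_norm_le x
  apply abs_le_of_sq_le_sq' _ (by positivity) |>.2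
  rw [mkW_sq]
  have := mkW_sq x
  have h2 := norm_add_le x h
  have h3 : ‖x + h‖ ^ 2 ≤ (‖x‖ + ‖h‖) ^ 2 := by gcongr
  nlinarith [norm_nonneg h]

lemma mkW_abs_sub {n : ℕ} (x h : EuclideanSpace ℝ (Fin n)) : |mkW (x + h) - mkW x| ≤ ‖h‖ := by
  rw [abs_le]
  have h1 := mkW_add_le x h
  have h2 := mkW_add_le (x + h) (-h)
  rw [add_neg_cancel_right, norm_neg] at h2
  constructor <;> linarith

lemma mkW_quad {n : ℕ} (x h : EuclideanSpace ℝ (Fin n)) :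
    mkW (x + h) - mkW x - ⟪(mkW x)⁻¹ • x, h⟫ ≤ ‖h‖ ^ 2 / 2 := by
  have h0 := mkW_one_le x
  have hpos : 0 < mkW x := by linarith
  have h1 := mkW_sq x
  have h2 := mkW_sq (x + h)
  rw [norm_add_sq_real] at h2
  rw [real_inner_smul_left]
  have h3 : 2 * mkW x * (mkW (x + h) - mkW x) ≤ 2 * ⟪x, h⟫ + ‖h‖ ^ 2 := by
    nlinarith [sq_nonneg (mkW (x + h) - mkW x)]
  have h4 : mkW (x + h) - mkW x ≤ (2 * ⟪x, h⟫ + ‖h‖ ^ 2) / (2 * mkW x) := by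
    rw [le_div_iff₀ (by positivity)]; linarith
  have h5 : (2 * ⟪x, h⟫ + ‖h‖ ^ 2) / (2 * mkW x) = (mkW x)⁻¹ * ⟪x, h⟫ + ‖h‖ ^ 2 / 2 * (mkW x)⁻¹ := by
    field_simp
  have h6 : ‖h‖ ^ 2 / 2 * (mkW x)⁻¹ ≤ ‖h‖ ^ 2 / 2 * 1 := by
    gcongr; exact inv_le_one_of_one_le₀ h0
  linarith

lemma mkW_grad_norm {n : ℕ} (x : EuclideanSpace ℝ (Fin n)) : ‖(mkW x)⁻¹ • x‖ ≤ 1 := by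
  have h0 := mkW_one_le x
  rw [norm_smul, norm_inv, Real.norm_of_nonneg (by linarith), inv_mul_le_iff₀ (by linarith)]
  linarith [mkW_norm_le x]

lemma mkW_continuous {n : ℕ} : Continuous (mkW (n := n)) := by
  unfold mkW; fun_prop

/-! ### Gradients -/

lemma mk_grad_eq {n : ℕ} (u : EuclideanSpace ℝ (Fin n) → ℝ) (x v : EuclideanSpace ℝ (Fin n))
    (C : ℝ) (hu : DifferentiableAt ℝ u x)
    (h : ∀ h, u (x + h) - u x ≤ ⟪v, h⟫ + C * ‖h‖ ^ 2) : gradient u x = v := by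
  have hg := hu.hasGradientAt.hasFDerivAt
  have hmax : IsLocalMax (fun z => u z - ⟪v, z - x⟫ - C * ‖z - x‖ ^ 2) x := by
    apply Eventually.of_forall
    intro z
    have := h (z - x)
    simp only [add_sub_cancel] at this
    simp only [sub_self, inner_zero_right, norm_zero]
    linarith
  have hd1 : HasFDerivAt (fun z => ⟪v, z - x⟫) (innerSL ℝ v) x := by
    have h1 := ((innerSL ℝ v).hasFDerivAt (x := x)).sub_const (⟪v, x⟫)
    refine h1.congr_of_eventuallyEq (Eventually.of_forall fun w => ?_)
    simp [inner_sub_right]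
  have hd2 : HasFDerivAt (fun z : EuclideanSpace ℝ (Fin n) => C * ‖z - x‖ ^ 2)
      (0 : EuclideanSpace ℝ (Fin n) →L[ℝ] ℝ) x := by
    have h1 : HasFDerivAt (fun z : EuclideanSpace ℝ (Fin n) => z - x)
        (ContinuousLinearMap.id ℝ _) x := (hasFDerivAt_id x).sub_const x
    have := h1.norm_sq.const_mul C
    simpa using this
  have := hmax.hasFDerivAt_eq_zero ((hg.sub hd1).sub hd2)
  apply ext_inner_right ℝ
  intro w
  have h2 := congrArg (fun L => L w) this
  have h3 : ⟪gradient u x, w⟫ - ⟪v, w⟫ - 0 = 0 := h2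
  linarith

lemma mk_lipschitz {n : ℕ} (u : EuclideanSpace ℝ (Fin n) → ℝ) (M : ℝ) (hu : Differentiable ℝ u)
    (h : ∀ x, ‖gradient u x‖ ≤ M) (x y : EuclideanSpace ℝ (Fin n)) : |u y - u x| ≤ M * ‖y - x‖ := by
  have := convex_univ.norm_image_sub_le_of_norm_fderiv_le (𝕜 := ℝ) (f := u) (C := M) (x := x) (y := y)
    (fun z _ => hu z) (fun z _ => ?_) (mem_univ _) (mem_univ _)
  · simpa [Real.norm_eq_abs] using this
  · have := h z
    rwa [gradient, LinearIsometryEquiv.norm_map] at this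

/-! ### Integrals -/

lemma mk_near (n d : ℕ) (hn : n + 1 = d) (hn1 : 1 ≤ n) : ∃ C : ℝ, 0 ≤ C ∧ ∀ L : ℝ, 0 < L →
    IntegrableOn (fun h : EuclideanSpace ℝ (Fin n) => ‖h‖ ^ 2 / ‖h‖ ^ d) (Metric.ball 0 L) ∧
    ∫ h in Metric.ball (0 : EuclideanSpace ℝ (Fin n)) L, ‖h‖ ^ 2 / ‖h‖ ^ d ≤ C * L := by
  subst hn
  have : Nonempty (Fin n) := ⟨⟨0, hn1⟩⟩
  have hone : ∀ y : ℝ, 0 < y → y ^ (n - 1) * (y ^ 2 / y ^ (n + 1)) = 1 := by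
    intro y hy
    have : y ^ (n + 1) = y ^ (n - 1) * y ^ 2 := by rw [← pow_add]; congr 1; omega
    rw [this]; field_simp
  refine ⟨n * volume.real (Metric.ball (0 : EuclideanSpace ℝ (Fin n)) 1), by positivity, ?_⟩
  intro L hL
  constructor
  · rw [integrableOn_fun_norm_addHaar volume (f := fun y : ℝ => y ^ 2 / y ^ (n + 1))]
    rw [finrank_euclideanSpace_fin]
    have : IntegrableOn (fun _ : ℝ => (1 : ℝ)) (Ioo 0 L) := by
      exact integrableOn_const (by simp)
    refine this.congr_fun (fun y hy => ?_) measurableSet_Ioo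
    exact (hone y hy.1).symm
  · rw [← integral_indicator measurableSet_ball]
    have e : (Metric.ball (0 : EuclideanSpace ℝ (Fin n)) L).indicator
        (fun h => ‖h‖ ^ 2 / ‖h‖ ^ (n + 1)) =
        fun h => (Iio L).indicator (fun y : ℝ => y ^ 2 / y ^ (n + 1)) ‖h‖ := by
      funext h; simp [indicator]
    rw [e, integral_fun_norm_addHaar volume, finrank_euclideanSpace_fin]
    have e2 : ∫ y in Ioi (0 : ℝ), y ^ (n - 1) • (Iio L).indicator (fun y : ℝ => y ^ 2 / y ^ (n + 1)) y
        = L := by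
      have : ∫ y in Ioi (0 : ℝ), y ^ (n - 1) •
          (Iio L).indicator (fun y : ℝ => y ^ 2 / y ^ (n + 1)) y =
          ∫ y in Ioi (0 : ℝ), (Iio L).indicator (fun _ => (1 : ℝ)) y := by
        apply setIntegral_congr_fun measurableSet_Ioi
        intro y hy
        by_cases h : y < L
        · simp [h, hone y hy]
        · simp [h]
      rw [this, integral_indicator measurableSet_Iio, Measure.restrict_restrict measurableSet_Iio,
        Iio_inter_Ioi]
      simp [hL.le]
    rw [e2]
    simp [mul_assoc]

lemma mk_far_integrable (n d : ℕ) (hn : n + 1 = d) (hn1 : 1 ≤ n) (Ω : ℝ → ℝ)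
    (hΩ : IntegrableOn (fun R => Ω R / R ^ 2) (Ioi 1)) :
    IntegrableOn (fun h : EuclideanSpace ℝ (Fin n) => Ω (2 * ‖h‖) / ‖h‖ ^ d) {h | 1 ≤ ‖h‖} := by
  subst hn
  have : Nonempty (Fin n) := ⟨⟨0, hn1⟩⟩
  have hmeas : MeasurableSet {h : EuclideanSpace ℝ (Fin n) | 1 ≤ ‖h‖} :=
    measurableSet_le measurable_const measurable_norm
  rw [← integrable_indicator_iff hmeas]
  have e : ({h : EuclideanSpace ℝ (Fin n) | 1 ≤ ‖h‖}).indicator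
        (fun h => Ω (2 * ‖h‖) / ‖h‖ ^ (n + 1)) =
        fun h => (Ici 1).indicator (fun y : ℝ => Ω (2 * y) / y ^ (n + 1)) ‖h‖ := by
      funext h; simp [indicator]
  rw [e, integrable_fun_norm_addHaar volume, finrank_euclideanSpace_fin]
  have h1 : IntegrableOn (fun y => 4 * (Ω (2 * y) / (2 * y) ^ 2)) (Ioi (1 / 2)) := by
    apply Integrable.const_mul
    have := (integrableOn_Ioi_comp_mul_left_iff (fun R => Ω R / R ^ 2) (1 / 2) (a := 2) two_pos).2
      (by simpa using hΩ)
    exact this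
  have h2 : IntegrableOn (fun y => 4 * (Ω (2 * y) / (2 * y) ^ 2)) (Ici 1) :=
    h1.mono_set (fun y hy => by simp at hy ⊢; linarith)
  have h3 := (integrable_indicator_iff measurableSet_Ici).2 h2
  refine (h3.integrableOn (s := Ioi 0)).congr_fun (fun y hy => ?_) measurableSet_Ioi
  have hy : 0 < y := hy
  by_cases h : 1 ≤ y
  · simp only [mem_Ici, h, indicator_of_mem, smul_eq_mul]
    have : y ^ (n + 1) = y ^ (n - 1) * y ^ 2 := by rw [← pow_add]; congr 1; omega
    rw [this]; field_simp; ring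
  · simp [h]

lemma mk_far_tendsto (n d : ℕ) (hn : n + 1 = d) (hn1 : 1 ≤ n) (Ω : ℝ → ℝ)
    (hΩ : IntegrableOn (fun R => Ω R / R ^ 2) (Ioi 1)) :
    Tendsto (fun L : ℝ => ∫ h in {h : EuclideanSpace ℝ (Fin n) | L ≤ ‖h‖}, Ω (2 * ‖h‖) / ‖h‖ ^ d)
      atTop (𝓝 0) := by
  have := tendsto_setIntegral_of_antitone (μ := volume)
    (s := fun L : ℝ => {h : EuclideanSpace ℝ (Fin n) | L ≤ ‖h‖})
    (f := fun h => Ω (2 * ‖h‖) / ‖h‖ ^ d)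
    (fun L => measurableSet_le measurable_const measurable_norm)
    (fun a b hab h hh => le_trans hab hh) ⟨1, mk_far_integrable n d hn hn1 Ω hΩ⟩
  have e : (⋂ L : ℝ, {h : EuclideanSpace ℝ (Fin n) | L ≤ ‖h‖}) = ∅ := by
    ext h
    simp only [mem_iInter, mem_ofPred_eq, mem_empty_iff_false, iff_false, not_forall, not_le]
    exact ⟨‖h‖ + 1, by linarith⟩
  rw [e] at this
  simpa using this

lemma mk_growth_tendsto (Ω : ℝ → ℝ) 
    (hΩ : IntegrableOn (fun R => Ω R / R ^ 2) (Ioi 1)) :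
    Tendsto (fun L : ℝ => ∫ R in Ioi L, Ω R / R ^ 2) atTop (𝓝 0) := by
  have := tendsto_setIntegral_of_antitone (μ := volume)
    (s := fun L : ℝ => Ioi L)
    (f := fun R => Ω R / R ^ 2)
    (fun L => measurableSet_Ioi)
    (fun a b hab h hh => lt_of_le_of_lt hab hh) ⟨1, hΩ⟩
  have e : (⋂ L : ℝ, Ioi L) = ∅ := by
    ext h
    simp only [mem_iInter, mem_Ioi, mem_empty_iff_false, iff_false, not_forall, not_lt]
    exact ⟨h, le_rfl⟩
  rw [e] at this
  simpa using this

lemma mk_growth (Ω : ℝ → ℝ) (hΩ : IntegrableOn (fun R => Ω R / R ^ 2) (Ioi 1)) (r v : ℝ)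
    (hr : 1 ≤ r) (hv : ∀ R, r ≤ R → v ≤ Ω R) : v ≤ (∫ R in Ioi r, Ω R / R ^ 2) * r := by
  have hi : IntegrableOn (fun R : ℝ => R ^ (-2 : ℝ)) (Ioi r) :=
    integrableOn_Ioi_rpow_of_lt (by norm_num) (by linarith)
  have h1 : ∫ R in Ioi r, v * R ^ (-2 : ℝ) ≤ ∫ R in Ioi r, Ω R / R ^ 2 := by
    apply setIntegral_mono_on (hi.const_mul v) (hΩ.mono_set (Ioi_subset_Ioi hr)) measurableSet_Ioi
    intro R hR
    have hR' : r < R := hR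
    have : 0 < R := by linarith
    rw [Real.rpow_neg this.le, div_eq_mul_inv]
    norm_cast
    gcongr
    exact hv R hR'.le
  rw [integral_const_mul, integral_Ioi_rpow_of_lt (by norm_num) (by linarith)] at h1
  have e : -r ^ ((-2 : ℝ) + 1) / (-2 + 1) = r⁻¹ := by
    norm_num
    rw [Real.rpow_neg_one]
  rw [e] at h1
  have hr0 : 0 < r := by linarith
  calc v = v * r⁻¹ * r := by field_simp
    _ ≤ _ := by gcongr

lemma mk_continuousOn {n : ℕ} (d : ℕ) (u : EuclideanSpace ℝ (Fin n) → ℝ) (hu : Continuous u)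
    (x : EuclideanSpace ℝ (Fin n)) :
    ContinuousOn (fun h => muskatIntegrand d u x h) {h | h ≠ 0} := by
  unfold muskatIntegrand
  apply ContinuousOn.div
  · fun_prop
  · apply ContinuousOn.rpow_const
    · fun_prop
    · intro h hh
      left
      have : 0 < ‖h‖ := norm_pos_iff.2 hh
      positivity
  · intro h hh
    have : 0 < ‖h‖ := norm_pos_iff.2 hh
    positivity

lemma mk_annulus_integrable {n : ℕ} (F : EuclideanSpace ℝ (Fin n) → ℝ)
    (hF : ContinuousOn F {h | h ≠ 0}) (a b : ℝ) (ha : 0 < a)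
    (S : Set (EuclideanSpace ℝ (Fin n))) (hS : ∀ h ∈ S, a ≤ ‖h‖ ∧ ‖h‖ ≤ b) :
    IntegrableOn F S := by
  have hK : IsCompact {h : EuclideanSpace ℝ (Fin n) | a ≤ ‖h‖ ∧ ‖h‖ ≤ b} := by
    apply (isCompact_closedBall (0 : EuclideanSpace ℝ (Fin n)) b).of_isClosed_subset
    · exact (isClosed_le continuous_const continuous_norm).inter
        (isClosed_le continuous_norm continuous_const)
    · intro h hh; simpa using hh.2
  refine IntegrableOn.mono_set (ContinuousOn.integrableOn_compact hK (hF.mono ?_)) hS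
  intro h hh h0
  have h1 : a ≤ ‖h‖ := hh.1
  rw [h0, norm_zero] at h1
  linarith

lemma mk_odd {n : ℕ} (d : ℕ) (v : EuclideanSpace ℝ (Fin n)) (L R : ℝ) :
    ∫ h in {h : EuclideanSpace ℝ (Fin n) | L ≤ ‖h‖ ∧ ‖h‖ < R}, ⟪v, h⟫ / ‖h‖ ^ d = 0 := by
  have hmeas : MeasurableSet {h : EuclideanSpace ℝ (Fin n) | L ≤ ‖h‖ ∧ ‖h‖ < R} :=
    (measurableSet_le measurable_const measurable_norm).inter
      (measurableSet_lt measurable_norm measurable_const)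
  rw [← integral_indicator hmeas]
  have h1 := integral_neg_eq_self (({h : EuclideanSpace ℝ (Fin n) | L ≤ ‖h‖ ∧ ‖h‖ < R}).indicator
    (fun h => ⟪v, h⟫ / ‖h‖ ^ d)) volume
  have h2 : ∀ h, ({h : EuclideanSpace ℝ (Fin n) | L ≤ ‖h‖ ∧ ‖h‖ < R}).indicator
    (fun h => ⟪v, h⟫ / ‖h‖ ^ d) (-h) = - ({h : EuclideanSpace ℝ (Fin n) | L ≤ ‖h‖ ∧ ‖h‖ < R}).indicator
    (fun h => ⟪v, h⟫ / ‖h‖ ^ d) h := by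
    intro h
    by_cases hh : L ≤ ‖h‖ ∧ ‖h‖ < R
    · simp [indicator, hh, neg_div]
    · simp only [indicator, mem_ofPred_eq, norm_neg, hh, if_false, neg_zero]
  simp_rw [h2] at h1
  rw [integral_neg] at h1
  linarith

lemma mk_tail (n d : ℕ) (hn : n + 1 = d) (hn1 : 1 ≤ n) (Ω : ℝ → ℝ) (hΩ0 : ∀ R, 0 ≤ Ω R)
    (hΩ : IntegrableOn (fun R => Ω R / R ^ 2) (Ioi 1))
    (u : EuclideanSpace ℝ (Fin n) → ℝ) (hu : Continuous u) (x : EuclideanSpace ℝ (Fin n))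
    (M L R : ℝ) (hL : 1 ≤ L) (hM : ‖gradient u x‖ ≤ M)
    (hb : ∀ h, L ≤ ‖h‖ → |u (x + h) - u x| ≤ 2 * Ω (2 * ‖h‖)) :
    |∫ h in {h : EuclideanSpace ℝ (Fin n) | L ≤ ‖h‖ ∧ ‖h‖ < R}, muskatIntegrand d u x h| ≤
      2 * (1 + d * M) * ∫ h in {h : EuclideanSpace ℝ (Fin n) | L ≤ ‖h‖}, Ω (2 * ‖h‖) / ‖h‖ ^ d := by
  have hM0 : 0 ≤ M := (norm_nonneg _).trans hM
  have hmeas : MeasurableSet {h : EuclideanSpace ℝ (Fin n) | L ≤ ‖h‖ ∧ ‖h‖ < R} :=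
    (measurableSet_le measurable_const measurable_norm).inter
      (measurableSet_lt measurable_norm measurable_const)
  have hI1 : IntegrableOn (fun h => muskatIntegrand d u x h)
      {h : EuclideanSpace ℝ (Fin n) | L ≤ ‖h‖ ∧ ‖h‖ < R} :=
    mk_annulus_integrable _ (mk_continuousOn d u hu x) L R (by linarith) _
      (fun h hh => ⟨hh.1, hh.2.le⟩)
  have hI2 : IntegrableOn (fun h => ⟪gradient u x, h⟫ / ‖h‖ ^ d)
      {h : EuclideanSpace ℝ (Fin n) | L ≤ ‖h‖ ∧ ‖h‖ < R} := by
    refine mk_annulus_integrable _ ?_ L R (by linarith) _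
      (fun h hh => ⟨hh.1, hh.2.le⟩)
    apply ContinuousOn.div (by fun_prop) (by fun_prop)
    intro h hh
    have : 0 < ‖h‖ := norm_pos_iff.2 hh
    positivity
  have e : ∫ h in {h : EuclideanSpace ℝ (Fin n) | L ≤ ‖h‖ ∧ ‖h‖ < R}, muskatIntegrand d u x h =
      ∫ h in {h : EuclideanSpace ℝ (Fin n) | L ≤ ‖h‖ ∧ ‖h‖ < R},
        (muskatIntegrand d u x h + ⟪gradient u x, h⟫ / ‖h‖ ^ d) := by
    rw [integral_add hI1 hI2, mk_odd, add_zero]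
  have hJ := (mk_far_integrable n d hn hn1 Ω hΩ).mono_set
    (t := {h | 1 ≤ ‖h‖}) (s := {h : EuclideanSpace ℝ (Fin n) | L ≤ ‖h‖}) (fun h hh => hL.trans hh)
  have hsub : {h : EuclideanSpace ℝ (Fin n) | L ≤ ‖h‖ ∧ ‖h‖ < R} ⊆ {h | L ≤ ‖h‖} := fun h hh => hh.1
  have hJ2 := hJ.mono_set hsub
  rw [e, ← Real.norm_eq_abs]
  calc _ ≤ ∫ h in {h : EuclideanSpace ℝ (Fin n) | L ≤ ‖h‖ ∧ ‖h‖ < R},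
        2 * (1 + d * M) * (Ω (2 * ‖h‖) / ‖h‖ ^ d) := by
        apply norm_integral_le_of_norm_le (hJ2.const_mul _)
        rw [ae_restrict_iff' hmeas]
        refine Eventually.of_forall fun h hh => ?_
        have hs : 0 < ‖h‖ := by linarith [hh.1]
        rw [Real.norm_eq_abs, muskatIntegrand]
        set a := u (x + h) - u x with ha
        set P := ⟪gradient u x, h⟫ with hP
        have hb' : |a| ≤ 2 * Ω (2 * ‖h‖) := hb h hh.1
        have hPb : |P| ≤ M * ‖h‖ := (abs_real_inner_le_norm _ _).trans (by gcongr)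
        have hbase := mk_base_ge d ‖h‖ a hs
        have hl := mk_lip d ‖h‖ a 0 hs
        have e0 : ((0 : ℝ) ^ 2 + ‖h‖ ^ 2) ^ ((d : ℝ) / 2) = ‖h‖ ^ d := by
          rw [← mk_pow_half d _ hs]; norm_num
        rw [e0, sub_zero] at hl
        set D := (a ^ 2 + ‖h‖ ^ 2) ^ ((d : ℝ) / 2) with hD
        have hsd : 0 < ‖h‖ ^ d := by positivity
        have e1 : (a - P) / D + P / ‖h‖ ^ d = a * (1 / D) - P * (1 / D - 1 / ‖h‖ ^ d) := by ring
        rw [e1]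
        have hD0 : 0 < D := hsd.trans_le hbase
        calc |a * (1 / D) - P * (1 / D - 1 / ‖h‖ ^ d)|
            ≤ |a * (1 / D)| + |P * (1 / D - 1 / ‖h‖ ^ d)| := abs_sub _ _
          _ = |a| * (1 / D) + |P| * |1 / D - 1 / ‖h‖ ^ d| := by
            rw [abs_mul, abs_mul, abs_of_pos (by positivity : 0 < 1 / D)]
          _ ≤ |a| * (1 / ‖h‖ ^ d) + M * ‖h‖ * (d / ‖h‖ ^ (d + 1) * |a|) := by gcongr
          _ = (1 + d * M) * |a| / ‖h‖ ^ d := by field_simp; ring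
          _ ≤ (1 + d * M) * (2 * Ω (2 * ‖h‖)) / ‖h‖ ^ d := by gcongr
          _ = _ := by ring
    _ = 2 * (1 + d * M) * ∫ h in {h : EuclideanSpace ℝ (Fin n) | L ≤ ‖h‖ ∧ ‖h‖ < R},
         (Ω (2 * ‖h‖) / ‖h‖ ^ d) := by rw [integral_const_mul]
    _ ≤ _ := by
        refine mul_le_mul_of_nonneg_left ?_ (by positivity)
        refine setIntegral_mono_set hJ ?_ hsub.eventuallyLE
        refine Eventually.of_forall fun h => ?_
        simp only [Pi.zero_apply]
        exact div_nonneg (hΩ0 _) (by positivity)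

/-! ### The static estimate at a doubled maximum -/

lemma mk_max_x {n : ℕ} (u v : EuclideanSpace ℝ (Fin n) → ℝ) (x y : EuclideanSpace ℝ (Fin n))
    (lam ε : ℝ) (hε : 0 < ε)
    (hmax : ∀ x' y', u x' - v y' - ‖x' - y'‖ ^ 2 / (2 * ε) - lam * mkW x' ≤
      u x - v y - ‖x - y‖ ^ 2 / (2 * ε) - lam * mkW x) (h : EuclideanSpace ℝ (Fin n)) :
    u (x + h) - u x ≤ ⟪ε⁻¹ • (x - y), h⟫ + ‖h‖ ^ 2 / (2 * ε) + lam * (mkW (x + h) - mkW x) := by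
  have h1 := hmax (x + h) y
  have e : x + h - y = (x - y) + h := by abel
  rw [e, norm_add_sq_real] at h1
  rw [real_inner_smul_left]
  have e2 : (‖x - y‖ ^ 2 + 2 * ⟪x - y, h⟫ + ‖h‖ ^ 2) / (2 * ε) =
    ‖x - y‖ ^ 2 / (2 * ε) + ε⁻¹ * ⟪x - y, h⟫ + ‖h‖ ^ 2 / (2 * ε) := by field_simp
  linarith

lemma mk_max_y {n : ℕ} (u v : EuclideanSpace ℝ (Fin n) → ℝ) (x y : EuclideanSpace ℝ (Fin n))
    (lam ε : ℝ) (hε : 0 < ε)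
    (hmax : ∀ x' y', u x' - v y' - ‖x' - y'‖ ^ 2 / (2 * ε) - lam * mkW x' ≤
      u x - v y - ‖x - y‖ ^ 2 / (2 * ε) - lam * mkW x) (h : EuclideanSpace ℝ (Fin n)) :
    ⟪ε⁻¹ • (x - y), h⟫ - ‖h‖ ^ 2 / (2 * ε) ≤ v (y + h) - v y := by
  have h1 := hmax x (y + h)
  have e : x - (y + h) = (x - y) - h := by abel
  rw [e, norm_sub_sq_real] at h1
  rw [real_inner_smul_left]
  have e2 : (‖x - y‖ ^ 2 - 2 * ⟪x - y, h⟫ + ‖h‖ ^ 2) / (2 * ε) =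
    ‖x - y‖ ^ 2 / (2 * ε) - ε⁻¹ * ⟪x - y, h⟫ + ‖h‖ ^ 2 / (2 * ε) := by field_simp
  linarith

lemma mk_grad_x {n : ℕ} (u v : EuclideanSpace ℝ (Fin n) → ℝ) (x y : EuclideanSpace ℝ (Fin n))
    (lam ε : ℝ) (hε : 0 < ε) (hlam : 0 ≤ lam) (hu : DifferentiableAt ℝ u x)
    (hmax : ∀ x' y', u x' - v y' - ‖x' - y'‖ ^ 2 / (2 * ε) - lam * mkW x' ≤
      u x - v y - ‖x - y‖ ^ 2 / (2 * ε) - lam * mkW x) :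
    gradient u x = ε⁻¹ • (x - y) + lam • ((mkW x)⁻¹ • x) := by
  apply mk_grad_eq u x _ (1 / (2 * ε) + lam / 2) hu
  intro h
  have h1 := mk_max_x u v x y lam ε hε hmax h
  have h2 := mul_le_mul_of_nonneg_left (mkW_quad x h) hlam
  rw [inner_add_left, real_inner_smul_left _ _ lam]
  have e : (1 / (2 * ε) + lam / 2) * ‖h‖ ^ 2 = ‖h‖ ^ 2 / (2 * ε) + lam * (‖h‖ ^ 2 / 2) := by ring
  rw [e]
  linarith

lemma mk_grad_y {n : ℕ} (u v : EuclideanSpace ℝ (Fin n) → ℝ) (x y : EuclideanSpace ℝ (Fin n))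
    (lam ε : ℝ) (hε : 0 < ε) (hv : DifferentiableAt ℝ v y)
    (hmax : ∀ x' y', u x' - v y' - ‖x' - y'‖ ^ 2 / (2 * ε) - lam * mkW x' ≤
      u x - v y - ‖x - y‖ ^ 2 / (2 * ε) - lam * mkW x) :
    gradient v y = ε⁻¹ • (x - y) := by
  have h0 : gradient (fun z => - v z) y = -(ε⁻¹ • (x - y)) := by
    apply mk_grad_eq _ y _ (1 / (2 * ε)) hv.neg
    intro h
    have h1 := mk_max_y u v x y lam ε hε hmax h
    rw [inner_neg_left]
    have e : (1 / (2 * ε)) * ‖h‖ ^ 2 = ‖h‖ ^ 2 / (2 * ε) := by ring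
    rw [e]
    simp only [Pi.neg_apply]
    linarith
  have h1 : gradient (fun z => - v z) y = - gradient v y := by
    simp [gradient, fderiv_fun_neg]
  rw [h1] at h0
  exact neg_injective h0

lemma mk_static (n d : ℕ) (hd : 1 ≤ d) (C : ℝ)
    (hC : ∀ L : ℝ, 0 < L →
      IntegrableOn (fun h : EuclideanSpace ℝ (Fin n) => ‖h‖ ^ 2 / ‖h‖ ^ d) (Metric.ball 0 L) ∧
      ∫ h in Metric.ball (0 : EuclideanSpace ℝ (Fin n)) L, ‖h‖ ^ 2 / ‖h‖ ^ d ≤ C * L)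
    (u v : EuclideanSpace ℝ (Fin n) → ℝ) (x y : EuclideanSpace ℝ (Fin n))
    (hu : Differentiable ℝ u) (hv : Differentiable ℝ v)
    (M m lam ε L η I J : ℝ) (hm : (2 * (d : ℝ) - 1) * m ^ 2 ≤ 1) (hlam : 0 ≤ lam) (hε : 0 < ε)
    (hMm : M ≤ m - 2 * lam) (hL : 0 < L)
    (hgu : ∀ z, ‖gradient u z‖ ≤ M) (hgv : ∀ z, ‖gradient v z‖ ≤ M)
    (hmax : ∀ x' y', u x' - v y' - ‖x' - y'‖ ^ 2 / (2 * ε) - lam * mkW x' ≤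
      u x - v y - ‖x - y‖ ^ 2 / (2 * ε) - lam * mkW x)
    (htu : ∀ R, |∫ h in {h : EuclideanSpace ℝ (Fin n) | L ≤ ‖h‖ ∧ ‖h‖ < R},
      muskatIntegrand d u x h| ≤ η)
    (htv : ∀ R, |∫ h in {h : EuclideanSpace ℝ (Fin n) | L ≤ ‖h‖ ∧ ‖h‖ < R},
      muskatIntegrand d v y h| ≤ η)
    (hI : HasPV (muskatIntegrand d u x) I) (hJ : HasPV (muskatIntegrand d v y) J) :
    I - J ≤ lam * (d / (2 * ε) + 1 / 2) * (C * L) + 2 * η := by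
  have hlim := Tendsto.sub hI hJ
  refine le_of_tendsto hlim ?_
  filter_upwards [eventually_gt_atTop L, eventually_gt_atTop L⁻¹] with R hR1 hR2
  have hR0 : 0 < R := hL.trans hR1
  have hRi : 0 < R⁻¹ := inv_pos.2 hR0
  have hRL : R⁻¹ < L := inv_lt_of_inv_lt₀ hL hR2
  set S1 : Set (EuclideanSpace ℝ (Fin n)) := {h | R⁻¹ < ‖h‖ ∧ ‖h‖ < L} with hS1
  set S2 : Set (EuclideanSpace ℝ (Fin n)) := {h | L ≤ ‖h‖ ∧ ‖h‖ < R} with hS2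
  have hm1 : MeasurableSet S1 := (measurableSet_lt measurable_const measurable_norm).inter
      (measurableSet_lt measurable_norm measurable_const)
  have hm2 : MeasurableSet S2 := (measurableSet_le measurable_const measurable_norm).inter
      (measurableSet_lt measurable_norm measurable_const)
  have hun : {h : EuclideanSpace ℝ (Fin n) | R⁻¹ < ‖h‖ ∧ ‖h‖ < R} = S1 ∪ S2 := by
    ext h
    constructor
    · intro hh
      have hh' : R⁻¹ < ‖h‖ ∧ ‖h‖ < R := hh
      rcases lt_or_ge ‖h‖ L with h1 | h1
      · exact Or.inl ⟨hh'.1, h1⟩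
      · exact Or.inr ⟨h1, hh'.2⟩
    · rintro (hh | hh)
      · exact ⟨hh.1, hh.2.trans hR1⟩
      · exact ⟨hRL.trans_le hh.1, hh.2⟩
  have hdis : Disjoint S1 S2 := by
    rw [Set.disjoint_left]
    intro h h1 h2
    exact absurd h1.2 (not_lt.2 h2.1)
  have iu1 := mk_annulus_integrable _ (mk_continuousOn d u hu.continuous x) R⁻¹ L hRi S1
    (fun h hh => ⟨hh.1.le, hh.2.le⟩)
  have iv1 := mk_annulus_integrable _ (mk_continuousOn d v hv.continuous y) R⁻¹ L hRi S1
    (fun h hh => ⟨hh.1.le, hh.2.le⟩)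
  have iu2 := mk_annulus_integrable _ (mk_continuousOn d u hu.continuous x) L R hL S2
    (fun h hh => ⟨hh.1, hh.2.le⟩)
  have iv2 := mk_annulus_integrable _ (mk_continuousOn d v hv.continuous y) L R hL S2
    (fun h hh => ⟨hh.1, hh.2.le⟩)
  rw [hun, setIntegral_union hdis hm2 iu1 iu2, setIntegral_union hdis hm2 iv1 iv2]
  have t1 := (abs_le.1 (htu R)).2
  have t2 := (abs_le.1 (htv R)).1
  have hgx := mk_grad_x u v x y lam ε hε hlam (hu x) hmax
  have hgy := mk_grad_y u v x y lam ε hε (hv y) hmax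
  obtain ⟨hC1, hC2⟩ := hC L hL
  have hsub : S1 ⊆ Metric.ball 0 L := fun h hh => by simpa using hh.2
  have key : ∫ h in S1, (muskatIntegrand d u x h - muskatIntegrand d v y h) ≤
      ∫ h in S1, lam * (d / (2 * ε) + 1 / 2) * (‖h‖ ^ 2 / ‖h‖ ^ d) := by
    apply setIntegral_mono_on (iu1.sub iv1) ((hC1.mono_set hsub).const_mul _) hm1
    intro h hh
    have hs : 0 < ‖h‖ := hRi.trans hh.1
    have hinner : ∀ w : EuclideanSpace ℝ (Fin n), ‖w‖ ≤ M → |⟪w, h⟫| ≤ (m - 2 * lam) * ‖h‖ := by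
      intro w hw
      exact (abs_real_inner_le_norm w h).trans (by gcongr; linarith)
    have hgx' : ⟪gradient u x, h⟫ = ⟪gradient v y, h⟫ + lam * ⟪(mkW x)⁻¹ • x, h⟫ := by
      rw [hgx, hgy, inner_add_left, real_inner_smul_left _ _ lam]
    have a1 : |u (x + h) - u x| ≤ (m - 2 * lam) * ‖h‖ := by
      have := mk_lipschitz u M hu hgu x (x + h)
      rw [add_sub_cancel_left] at this
      exact this.trans (by gcongr)
    have a2 : |v (y + h) - v y| ≤ (m - 2 * lam) * ‖h‖ := by
      have := mk_lipschitz v M hv hgv y (y + h)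
      rw [add_sub_cancel_left] at this
      exact this.trans (by gcongr)
    have a3 : u (x + h) - u x ≤ v (y + h) - v y + lam * (mkW (x + h) - mkW x) := by
      have := hmax (x + h) (y + h)
      rw [add_sub_add_right_eq_sub] at this
      linarith
    have a4 := mk_max_x u v x y lam ε hε hmax h
    have a5 := mk_max_y u v x y lam ε hε hmax h
    rw [← hgy] at a4 a5
    simp only [Pi.sub_apply, muskatIntegrand]
    have a6 := hinner _ (hgu x)
    rw [hgx'] at a6 ⊢
    exact mk_pointwise d hd ‖h‖ m _ _ _ _ (mkW (x + h) - mkW x) lam ε hs hm hlam hε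
      (hinner _ (hgv y)) a6 a1 a2 (mkW_abs_sub x h) (mkW_quad x h) a3 a4 a5
  rw [integral_sub iu1 iv1, integral_const_mul] at key
  have k2 : ∫ h in S1, ‖h‖ ^ 2 / ‖h‖ ^ d ≤ C * L := by
    refine le_trans (setIntegral_mono_set hC1 ?_ hsub.eventuallyLE) hC2
    refine Eventually.of_forall fun h => ?_
    simp only [Pi.zero_apply]
    positivity
  have k3 : lam * (d / (2 * ε) + 1 / 2) * ∫ h in S1, ‖h‖ ^ 2 / ‖h‖ ^ d ≤
      lam * (d / (2 * ε) + 1 / 2) * (C * L) :=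
    mul_le_mul_of_nonneg_left k2 (by positivity)
  linarith

/-! ### Soft lemmas -/

lemma mk_exists_max {n : ℕ} (Φ : ℝ × EuclideanSpace ℝ (Fin n) × EuclideanSpace ℝ (Fin n) → ℝ)
    (t0 t1 C a b : ℝ) (ha : 0 < a) (hb : 0 < b)
    (hcont : ContinuousOn Φ (Icc t0 t1 ×ˢ univ))
    (hbd : ∀ t ∈ Icc t0 t1, ∀ x y, Φ (t, x, y) ≤ C - a * ‖x‖ - b * ‖x - y‖ ^ 2)
    (ts : ℝ) (xs : EuclideanSpace ℝ (Fin n)) (hts : ts ∈ Icc t0 t1) (hpos : 0 < Φ (ts, xs, xs)) :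
    ∃ t ∈ Icc t0 t1, ∃ x y, ∀ t' ∈ Icc t0 t1, ∀ x' y', Φ (t', x', y') ≤ Φ (t, x, y) := by
  have hC : 0 < C := by
    have := hbd ts hts xs xs
    simp only [sub_self, norm_zero] at this
    have h2 : 0 ≤ a * ‖xs‖ := by positivity
    linarith
  set ρ : ℝ := C / a + C / b + 1 with hρ
  have hin : ∀ t ∈ Icc t0 t1, ∀ x y, 0 ≤ Φ (t, x, y) → ‖x‖ ≤ ρ ∧ ‖y‖ ≤ ρ := by
    intro t ht x y h0
    have h1 := hbd t ht x y
    have h2 : 0 ≤ a * ‖x‖ := by positivity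
    have h3 : 0 ≤ b * ‖x - y‖ ^ 2 := by positivity
    have h4 : ‖x‖ ≤ C / a := by rw [le_div_iff₀ ha]; linarith
    have h5 : ‖x - y‖ ^ 2 ≤ C / b := by rw [le_div_iff₀ hb]; linarith
    have h6 : ‖x - y‖ ≤ C / b + 1 := by nlinarith [sq_nonneg (‖x - y‖ - 1)]
    have h7 : ‖y‖ ≤ ‖x‖ + ‖x - y‖ := by
      have := norm_sub_le x (x - y)
      simpa using this
    have h8 : 0 ≤ C / b := by positivity
    constructor <;> linarith
  have hK : IsCompact (Icc t0 t1 ×ˢ (Metric.closedBall (0 : EuclideanSpace ℝ (Fin n)) ρ ×ˢ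
      Metric.closedBall (0 : EuclideanSpace ℝ (Fin n)) ρ)) :=
    isCompact_Icc.prod ((isCompact_closedBall _ _).prod (isCompact_closedBall _ _))
  have hsm : (ts, xs, xs) ∈ Icc t0 t1 ×ˢ (Metric.closedBall (0 : EuclideanSpace ℝ (Fin n)) ρ ×ˢ
      Metric.closedBall (0 : EuclideanSpace ℝ (Fin n)) ρ) := by
    have := hin ts hts xs xs hpos.le
    exact ⟨hts, by simpa using this.1, by simpa using this.1⟩
  obtain ⟨⟨t, x, y⟩, hz, hzm⟩ := hK.exists_isMaxOn ⟨_, hsm⟩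
    (hcont.mono (prod_mono_right (subset_univ _)))
  refine ⟨t, hz.1, x, y, ?_⟩
  intro t' ht' x' y'
  have hge : Φ (ts, xs, xs) ≤ Φ (t, x, y) := hzm hsm
  rcases lt_or_ge (Φ (t', x', y')) 0 with h | h
  · linarith
  · have := hin t' ht' x' y' h
    exact hzm (show (t', x', y') ∈ _ from ⟨ht', by simpa using this.1, by simpa using this.2⟩)

lemma mk_deriv_nonneg (φ : ℝ → ℝ) (φ' t0 t : ℝ) (h : HasDerivAt φ φ' t) (ht : t0 < t)
    (hle : ∀ s ∈ Icc t0 t, φ s ≤ φ t) : 0 ≤ φ' := by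
  have h1 := (hasDerivWithinAt_iff_tendsto_slope' (s := Iio t) (by simp)).1 h.hasDerivWithinAt
  refine ge_of_tendsto h1 ?_
  have : ∀ᶠ s in 𝓝[<] t, s ∈ Ioo t0 t := Ioo_mem_nhdsLT ht
  filter_upwards [this] with s hs
  have h2 := hle s ⟨hs.1.le, hs.2.le⟩
  rw [slope_def_field]
  apply div_nonneg_of_nonpos <;> linarith [hs.2]

lemma mk_diffAt {d : ℕ} {T : ℝ} {rel : ℝ → ℝ → Prop}
    {f : ℝ → EuclideanSpace ℝ (Fin (d - 1)) → ℝ} (hf : IsClassicalMuskat d T rel f)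
    {t : ℝ} (ht : t ∈ Ioo 0 T) (x : EuclideanSpace ℝ (Fin (d - 1))) :
    DifferentiableAt ℝ (fun p : ℝ × EuclideanSpace ℝ (Fin (d - 1)) => f p.1 p.2) (t, x) := by
  apply (hf.smooth.differentiableOn (by norm_num)).differentiableAt
  exact (isOpen_Ioo.prod isOpen_univ).mem_nhds ⟨ht, mem_univ _⟩

lemma mk_diff_x {d : ℕ} {T : ℝ} {rel : ℝ → ℝ → Prop}
    {f : ℝ → EuclideanSpace ℝ (Fin (d - 1)) → ℝ} (hf : IsClassicalMuskat d T rel f)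
    {t : ℝ} (ht : t ∈ Ioo 0 T) : Differentiable ℝ (f t) := by
  intro x
  exact (mk_diffAt hf ht x).comp x
    ((differentiableAt_const t).prodMk differentiableAt_id)

lemma mk_diff_t {d : ℕ} {T : ℝ} {rel : ℝ → ℝ → Prop}
    {f : ℝ → EuclideanSpace ℝ (Fin (d - 1)) → ℝ} (hf : IsClassicalMuskat d T rel f)
    {t : ℝ} (ht : t ∈ Ioo 0 T) (x : EuclideanSpace ℝ (Fin (d - 1))) :
    DifferentiableAt ℝ (fun s => f s x) t := by
  have h1 : DifferentiableAt ℝ (fun s : ℝ => (s, x)) t :=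
    differentiableAt_id.prodMk (differentiableAt_const x)
  exact DifferentiableAt.comp (g := fun p : ℝ × EuclideanSpace ℝ (Fin (d - 1)) => f p.1 p.2)
    t (mk_diffAt hf ht x) h1

/-- Comparison in the open time interval. -/
lemma mk_interior (d : ℕ) (hd : 2 ≤ d) (T : ℝ)
    (f g : ℝ → EuclideanSpace ℝ (Fin (d - 1)) → ℝ)
    (hf : IsClassicalMuskat d T (· ≤ ·) f)
    (hg : IsClassicalMuskat d T (fun a b => b ≤ a) g)
    (M m : ℝ) (hMm : M < m) (hm : (2 * (d : ℝ) - 1) * m ^ 2 ≤ 1) (hM0 : 0 ≤ M)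
    (hfs : ∀ t ∈ Icc 0 T, ∀ x, ‖gradient (f t) x‖ ≤ M)
    (hgs : ∀ t ∈ Icc 0 T, ∀ x, ‖gradient (g t) x‖ ≤ M)
    (h0 : ∀ x, f 0 x ≤ g 0 x) (ts : ℝ) (hts : ts ∈ Ioo 0 T)
    (xs : EuclideanSpace ℝ (Fin (d - 1))) : f ts xs ≤ g ts xs := by
  by_contra hcon
  push Not at hcon
  have hn : d - 1 + 1 = d := by omega
  have hn1 : 1 ≤ d - 1 := by omega
  have hd1 : 1 ≤ d := by omega
  obtain ⟨θ, hθ, hθeq⟩ : ∃ θ : ℝ, 0 < θ ∧ f ts xs - g ts xs = 4 * θ :=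
    ⟨(f ts xs - g ts xs) / 4, by linarith, by ring⟩
  obtain ⟨C, hC0, hC⟩ := mk_near (d - 1) d hn hn1
  -- the doubling parameter
  obtain ⟨ε, hε, hεM1, hεM2⟩ : ∃ ε : ℝ, 0 < ε ∧ ε * M ≤ 1 ∧ ε * M ^ 2 ≤ θ / 2 := by
    refine ⟨min 1 (θ / 2) / (1 + M) ^ 2, by positivity, ?_, ?_⟩
    · rw [div_mul_eq_mul_div, div_le_one (by positivity)]
      have : min 1 (θ / 2) * M ≤ 1 * M := by gcongr; exact min_le_left _ _
      nlinarith
    · rw [div_mul_eq_mul_div, div_le_iff₀ (by positivity)]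
      have : min 1 (θ / 2) * M ^ 2 ≤ (θ / 2) * M ^ 2 := by gcongr; exact min_le_right _ _
      nlinarith
  -- the initial time
  obtain ⟨t0, ⟨ht00, ht0s⟩, hft0, hgt0⟩ : ∃ t0, t0 ∈ Ioo 0 ts ∧ (∀ x, |f t0 x - f 0 x| < θ / 4) ∧
      (∀ x, |g t0 x - g 0 x| < θ / 4) := by
    have e1 := Metric.tendstoUniformly_iff.1 hf.limit_zero (θ / 4) (by positivity)
    have e2 := Metric.tendstoUniformly_iff.1 hg.limit_zero (θ / 4) (by positivity)
    have e3 : ∀ᶠ s in 𝓝[>] (0 : ℝ), s ∈ Ioo 0 ts := Ioo_mem_nhdsGT hts.1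
    obtain ⟨s, h1, h2, h3⟩ := (e1.and (e2.and e3)).exists
    refine ⟨s, h3, fun x => ?_, fun x => ?_⟩
    · have := h1 x
      rwa [dist_comm, Real.dist_eq] at this
    · have := h2 x
      rwa [dist_comm, Real.dist_eq] at this
  have hIoo : ∀ t ∈ Icc t0 ts, t ∈ Ioo 0 T := fun t ht =>
    ⟨ht00.trans_le ht.1, ht.2.trans_lt hts.2⟩
  have hflip : ∀ t ∈ Ioo 0 T, ∀ x y, |f t y - f t x| ≤ M * ‖y - x‖ := fun t ht =>
    mk_lipschitz (f t) M (mk_diff_x hf ht) (hfs t (Ioo_subset_Icc_self ht))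
  have hglip : ∀ t ∈ Ioo 0 T, ∀ x y, |g t y - g t x| ≤ M * ‖y - x‖ := fun t ht =>
    mk_lipschitz (g t) M (mk_diff_x hg ht) (hgs t (Ioo_subset_Icc_self ht))
  have hg0lip : ∀ x y, g 0 y - g 0 x ≤ M * ‖y - x‖ := by
    intro x y
    have l1 := (hg.limit_zero.tendsto_at y).sub (hg.limit_zero.tendsto_at x)
    refine le_of_tendsto l1 ?_
    have e3 : ∀ᶠ s in 𝓝[>] (0 : ℝ), s ∈ Ioo 0 T := Ioo_mem_nhdsGT (hts.1.trans hts.2)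
    filter_upwards [e3] with s hs
    exact (le_abs_self _).trans (hglip s hs x y)
  -- growth functions
  have hKc : IsCompact (Icc t0 ts ×ˢ ({0} : Set (EuclideanSpace ℝ (Fin (d - 1))))) :=
    isCompact_Icc.prod isCompact_singleton
  have hKs : (Icc t0 ts ×ˢ ({0} : Set (EuclideanSpace ℝ (Fin (d - 1))))) ⊆ Ioo 0 T ×ˢ univ :=
    fun p hp => ⟨hIoo _ hp.1, mem_univ _⟩
  obtain ⟨-, Ωf, -, hΩf0, -, hΩf, -, hΩfi⟩ := hf.local_bounds _ hKc hKs
  obtain ⟨-, Ωg, -, hΩg0, -, hΩg, -, hΩgi⟩ := hg.local_bounds _ hKc hKs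
  have hΩf' : ∀ t ∈ Icc t0 ts, ∀ R > (0 : ℝ), ∀ h, ‖h‖ ≤ R → |f t h - f t 0| ≤ Ωf R := by
    intro t ht R hR h hh
    have := hΩf (t, 0) ⟨ht, rfl⟩ R hR h hh
    simpa using this
  have hΩg' : ∀ t ∈ Icc t0 ts, ∀ R > (0 : ℝ), ∀ h, ‖h‖ ≤ R → |g t h - g t 0| ≤ Ωg R := by
    intro t ht R hR h hh
    have := hΩg (t, 0) ⟨ht, rfl⟩ R hR h hh
    simpa using this
  -- the tail parameter
  obtain ⟨η, hη, hηT⟩ : ∃ η : ℝ, 0 < η ∧ 3 * η * ts ≤ θ := by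
    have := hts.1
    refine ⟨θ / (3 * ts), by positivity, ?_⟩
    apply le_of_eq; field_simp
  obtain ⟨L0, hL01, hL0⟩ : ∃ L0 : ℝ, 1 ≤ L0 ∧ ∀ L ≥ L0,
      2 * (1 + d * M) * (∫ h in {h : EuclideanSpace ℝ (Fin (d - 1)) | L ≤ ‖h‖},
        Ωf (2 * ‖h‖) / ‖h‖ ^ d) ≤ η ∧
      2 * (1 + d * M) * (∫ h in {h : EuclideanSpace ℝ (Fin (d - 1)) | L ≤ ‖h‖},
        Ωg (2 * ‖h‖) / ‖h‖ ^ d) ≤ η := by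
    have l1 := (mk_far_tendsto (d - 1) d hn hn1 Ωf hΩfi).const_mul (2 * (1 + d * M))
    have l2 := (mk_far_tendsto (d - 1) d hn hn1 Ωg hΩgi).const_mul (2 * (1 + d * M))
    rw [mul_zero] at l1 l2
    obtain ⟨L1, hL1⟩ := eventually_atTop.1
      ((l1.eventually_le_const hη).and (l2.eventually_le_const hη))
    exact ⟨max 1 L1, le_max_left _ _, fun L hL => hL1 L ((le_max_right _ _).trans hL)⟩
  -- the weight parameters
  obtain ⟨B, hB⟩ : ∃ B : ℝ, B = (d / (2 * ε) + 1 / 2) * C * (L0 + 2) := ⟨_, rfl⟩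
  have hB0 : 0 ≤ B := by rw [hB]; positivity
  have hWs : 0 < mkW xs := by linarith [mkW_one_le xs]
  obtain ⟨κ, hκ, hκ1, hκ2⟩ : ∃ κ : ℝ, 0 < κ ∧ (∀ t ≤ ts, M ≤ m - 2 * (κ * Real.exp (B * t))) ∧
      κ * Real.exp (B * ts) * mkW xs ≤ θ := by
    have hmM : 0 < (m - M) / 2 := by linarith
    have hE : 0 < Real.exp (B * ts) := Real.exp_pos _
    refine ⟨min ((m - M) / 2) (θ / mkW xs) / Real.exp (B * ts), by positivity, ?_, ?_⟩
    · intro t ht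
      have h1 : Real.exp (B * t) ≤ Real.exp (B * ts) := by gcongr
      have h2 : min ((m - M) / 2) (θ / mkW xs) / Real.exp (B * ts) * Real.exp (B * t) ≤
          (m - M) / 2 := by
        calc _ ≤ min ((m - M) / 2) (θ / mkW xs) / Real.exp (B * ts) * Real.exp (B * ts) := by
              gcongr
          _ = min ((m - M) / 2) (θ / mkW xs) := by field_simp
          _ ≤ _ := min_le_left _ _
      linarith
    · rw [div_mul_cancel₀ _ hE.ne']
      calc _ ≤ θ / mkW xs * mkW xs := by gcongr; exact min_le_right _ _
        _ = θ := by field_simp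
  -- the doubled functional
  obtain ⟨Φ, hΦ⟩ : ∃ Φ : ℝ × EuclideanSpace ℝ (Fin (d - 1)) × EuclideanSpace ℝ (Fin (d - 1)) → ℝ,
      Φ = fun z => f z.1 z.2.1 - g z.1 z.2.2 - ‖z.2.1 - z.2.2‖ ^ 2 / (2 * ε) -
        κ * Real.exp (B * z.1) * mkW z.2.1 - 3 * η * z.1 := ⟨_, rfl⟩
  have hΦs : 2 * θ ≤ Φ (ts, xs, xs) := by
    rw [hΦ]
    simp only [sub_self, norm_zero]
    norm_num
    linarith
  have hcf : ContinuousOn (fun p : ℝ × EuclideanSpace ℝ (Fin (d - 1)) => f p.1 p.2)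
      (Icc t0 ts ×ˢ univ) := hf.smooth.continuousOn.mono (fun p hp => ⟨hIoo _ hp.1, mem_univ _⟩)
  have hcg : ContinuousOn (fun p : ℝ × EuclideanSpace ℝ (Fin (d - 1)) => g p.1 p.2)
      (Icc t0 ts ×ˢ univ) := hg.smooth.continuousOn.mono (fun p hp => ⟨hIoo _ hp.1, mem_univ _⟩)
  have hcont : ContinuousOn Φ (Icc t0 ts ×ˢ univ) := by
    have c1 : ContinuousOn (fun z : ℝ × EuclideanSpace ℝ (Fin (d - 1)) ×
        EuclideanSpace ℝ (Fin (d - 1)) => f z.1 z.2.1) (Icc t0 ts ×ˢ univ) :=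
      hcf.comp (f := fun z : ℝ × EuclideanSpace ℝ (Fin (d - 1)) ×
        EuclideanSpace ℝ (Fin (d - 1)) => (z.1, z.2.1)) (by fun_prop)
        (fun z hz => ⟨hz.1, mem_univ _⟩)
    have c2 : ContinuousOn (fun z : ℝ × EuclideanSpace ℝ (Fin (d - 1)) ×
        EuclideanSpace ℝ (Fin (d - 1)) => g z.1 z.2.2) (Icc t0 ts ×ˢ univ) :=
      hcg.comp (f := fun z : ℝ × EuclideanSpace ℝ (Fin (d - 1)) ×
        EuclideanSpace ℝ (Fin (d - 1)) => (z.1, z.2.2)) (by fun_prop)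
        (fun z hz => ⟨hz.1, mem_univ _⟩)
    have c3 : Continuous (fun z : ℝ × EuclideanSpace ℝ (Fin (d - 1)) ×
        EuclideanSpace ℝ (Fin (d - 1)) => ‖z.2.1 - z.2.2‖ ^ 2 / (2 * ε)) := by fun_prop
    have c4 : Continuous (fun z : ℝ × EuclideanSpace ℝ (Fin (d - 1)) ×
        EuclideanSpace ℝ (Fin (d - 1)) => κ * Real.exp (B * z.1) * mkW z.2.1) := by
      have := mkW_continuous (n := d - 1)
      fun_prop
    have c5 : Continuous (fun z : ℝ × EuclideanSpace ℝ (Fin (d - 1)) ×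
        EuclideanSpace ℝ (Fin (d - 1)) => 3 * η * z.1) := by fun_prop
    rw [hΦ]
    exact (((c1.sub c2).sub c3.continuousOn).sub c4.continuousOn).sub c5.continuousOn
  -- elementary quadratic bound
  have hquad : ∀ r : ℝ, M * r ≤ ε * M ^ 2 + (4 * ε)⁻¹ * r ^ 2 := by
    intro r
    have h1 : ε * M ^ 2 + (4 * ε)⁻¹ * r ^ 2 - M * r = ε * (M - r / (2 * ε)) ^ 2 := by
      field_simp; ring
    have h2 : 0 ≤ ε * (M - r / (2 * ε)) ^ 2 := by positivity
    linarith
  have hsplit : ∀ r : ℝ, r ^ 2 / (2 * ε) = (4 * ε)⁻¹ * r ^ 2 + (4 * ε)⁻¹ * r ^ 2 := by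
    intro r; field_simp; ring
  -- coercivity
  obtain ⟨C1, hC1⟩ : ∃ C1 : ℝ, ∀ t ∈ Icc t0 ts, ∀ x y,
      Φ (t, x, y) ≤ C1 - κ / 2 * ‖x‖ - (4 * ε)⁻¹ * ‖x - y‖ ^ 2 := by
    have hκ4 : 0 < κ / 4 := by positivity
    obtain ⟨R1, hR1⟩ := eventually_atTop.1
      (((mk_growth_tendsto Ωf hΩfi).eventually_le_const hκ4).and
        ((mk_growth_tendsto Ωg hΩgi).eventually_le_const hκ4))
    obtain ⟨R0, hR0⟩ : ∃ R0, R0 = max 1 R1 := ⟨_, rfl⟩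
    have hR01 : 1 ≤ R0 := hR0 ▸ le_max_left _ _
    have hR0' : R1 ≤ R0 := hR0 ▸ le_max_right _ _
    obtain ⟨C0, hC0'⟩ : ∃ C0 : ℝ, ∀ t ∈ Icc t0 ts, f t 0 - g t 0 ≤ C0 := by
      have cc : ContinuousOn (fun t => f t 0 - g t 0) (Icc t0 ts) := by
        refine ContinuousOn.sub ?_ ?_
        · exact hcf.comp (f := fun t : ℝ => (t, (0 : EuclideanSpace ℝ (Fin (d - 1)))))
            (by fun_prop) (fun t ht => ⟨ht, mem_univ _⟩)
        · exact hcg.comp (f := fun t : ℝ => (t, (0 : EuclideanSpace ℝ (Fin (d - 1)))))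
            (by fun_prop) (fun t ht => ⟨ht, mem_univ _⟩)
      obtain ⟨C0, h⟩ := isCompact_Icc.bddAbove_image cc
      exact ⟨C0, fun t ht => h ⟨t, ht, rfl⟩⟩
    have hgrow : ∀ (u : EuclideanSpace ℝ (Fin (d - 1)) → ℝ) (Ω : ℝ → ℝ),
        IntegrableOn (fun R => Ω R / R ^ 2) (Ioi 1) →
        (∀ r ≥ R0, ∫ R in Ioi r, Ω R / R ^ 2 ≤ κ / 4) →
        (∀ R > (0 : ℝ), ∀ h, ‖h‖ ≤ R → |u h - u 0| ≤ Ω R) →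
        (∀ x y, |u y - u x| ≤ M * ‖y - x‖) → ∀ x, |u x - u 0| ≤ κ / 4 * ‖x‖ + M * R0 := by
      intro u Ω hi hr hb hl x
      rcases le_or_gt R0 ‖x‖ with h | h
      · have h1 := mk_growth Ω hi ‖x‖ (|u x - u 0|) (hR01.trans h)
          (fun R hR => hb R (by linarith) x hR)
        have h2 : (∫ R in Ioi ‖x‖, Ω R / R ^ 2) * ‖x‖ ≤ κ / 4 * ‖x‖ := by
          gcongr; exact hr _ h
        have h3 : 0 ≤ M * R0 := by positivity
        linarith
      · have h1 := hl 0 x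
        rw [sub_zero] at h1
        have h2 : M * ‖x‖ ≤ M * R0 := by gcongr
        have h3 : 0 ≤ κ / 4 * ‖x‖ := by positivity
        linarith
    refine ⟨C0 + 2 * (M * R0) + ε * M ^ 2, ?_⟩
    intro t ht x y
    have a1 := (abs_le.1 (hgrow (f t) Ωf hΩfi (fun r hr => (hR1 r (hR0'.trans hr)).1)
      (hΩf' t ht) (hflip t (hIoo t ht)) x)).2
    have a2 := (abs_le.1 (hgrow (g t) Ωg hΩgi (fun r hr => (hR1 r (hR0'.trans hr)).2)
      (hΩg' t ht) (hglip t (hIoo t ht)) x)).1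
    have a3 := (abs_le.1 (hglip t (hIoo t ht) y x)).2
    have a4 := hC0' t ht
    have a5 := hquad ‖x - y‖
    have a6 := hsplit ‖x - y‖
    have ht0 : 0 < t := (hIoo t ht).1
    have a7 : κ * ‖x‖ ≤ κ * Real.exp (B * t) * mkW x := by
      have h1 : 1 ≤ Real.exp (B * t) := Real.one_le_exp (by positivity)
      calc κ * ‖x‖ = κ * 1 * ‖x‖ := by ring
        _ ≤ _ := by gcongr; exact mkW_norm_le x
    have a8 : 0 ≤ 3 * η * t := by positivity
    rw [hΦ]
    simp only
    linarith
  obtain ⟨t, ht, x, y, hmax⟩ := mk_exists_max Φ t0 ts C1 (κ / 2) (4 * ε)⁻¹ (by positivity)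
    (by positivity) hcont hC1 ts xs ⟨ht0s.le, le_rfl⟩ (by linarith)
  have htI := hIoo t ht
  have hval : 2 * θ ≤ Φ (t, x, y) := hΦs.trans (hmax ts ⟨ht0s.le, le_rfl⟩ xs xs)
  have hκe : 0 < κ * Real.exp (B * t) := by positivity
  have hW1 := mkW_one_le x
  -- the maximum is not attained at the initial time
  have hne : t0 < t := by
    rcases lt_or_eq_of_le ht.1 with h | h
    · exact h
    · exfalso
      rw [← h] at hval hκe
      rw [hΦ] at hval
      simp only at hval
      have b1 := (abs_le.1 (hft0 x).le).2
      have b2 := (abs_le.1 (hgt0 y).le).1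
      have b3 := h0 x
      have b4 := hg0lip y x
      have b5 := hquad ‖x - y‖
      have b6 := hsplit ‖x - y‖
      have b7 : 0 ≤ κ * Real.exp (B * t0) * mkW x := by positivity
      have b8 : 0 ≤ 3 * η * t0 := by positivity
      have b9 : 0 ≤ (4 * ε)⁻¹ * ‖x - y‖ ^ 2 := by positivity
      linarith
  -- the static maximum
  have hmaxs : ∀ x' y', f t x' - g t y' - ‖x' - y'‖ ^ 2 / (2 * ε) -
      κ * Real.exp (B * t) * mkW x' ≤
      f t x - g t y - ‖x - y‖ ^ 2 / (2 * ε) - κ * Real.exp (B * t) * mkW x := by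
    intro x' y'
    have := hmax t ht x' y'
    rw [hΦ] at this
    simp only at this
    linarith
  have hgy := mk_grad_y (f t) (g t) x y _ ε hε (mk_diff_x hg htI y) hmaxs
  have hxy : ‖x - y‖ ≤ 1 := by
    have h1 := hgs t (Ioo_subset_Icc_self htI) y
    rw [hgy, norm_smul, norm_inv, Real.norm_of_nonneg hε.le, inv_mul_le_iff₀ hε] at h1
    linarith
  have hyn : ‖y‖ ≤ ‖x‖ + 1 := by
    have := norm_sub_le x (x - y)
    rw [sub_sub_cancel] at this
    linarith
  obtain ⟨L, hL⟩ : ∃ L, L = L0 + mkW x + 1 := ⟨_, rfl⟩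
  have hxW := mkW_norm_le x
  have hLL : L0 ≤ L := by linarith
  have hL1 : 1 ≤ L := hL01.trans hLL
  have htail : ∀ (u : EuclideanSpace ℝ (Fin (d - 1)) → ℝ) (Ω : ℝ → ℝ),
      (∀ R > (0 : ℝ), ∀ h, ‖h‖ ≤ R → |u h - u 0| ≤ Ω R) → ∀ z, ‖z‖ ≤ L →
      ∀ h, L ≤ ‖h‖ → |u (z + h) - u z| ≤ 2 * Ω (2 * ‖h‖) := by
    intro u Ω hb z hz h hh
    have h1 := hb (2 * ‖h‖) (by linarith) (z + h) ((norm_add_le z h).trans (by linarith))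
    have h2 := hb (2 * ‖h‖) (by linarith) z (by linarith)
    rw [abs_le] at h1 h2 ⊢
    constructor <;> linarith [h1.1, h1.2, h2.1, h2.2]
  obtain ⟨I, hI, hIle⟩ := hf.eqn t htI x
  obtain ⟨J, hJ, hJle⟩ := hg.eqn t htI y
  have hst := mk_static (d - 1) d hd1 C hC (f t) (g t) x y (mk_diff_x hf htI) (mk_diff_x hg htI)
    M m (κ * Real.exp (B * t)) ε L η I J hm hκe.le hε (hκ1 t ht.2) (by linarith)
    (hfs t (Ioo_subset_Icc_self htI)) (hgs t (Ioo_subset_Icc_self htI)) hmaxs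
    (fun R => (mk_tail (d - 1) d hn hn1 Ωf hΩf0 hΩfi (f t) (mk_diff_x hf htI).continuous x M L R hL1
      (hfs t (Ioo_subset_Icc_self htI) x) (htail (f t) Ωf (hΩf' t ht) x (by linarith))).trans
        (hL0 L hLL).1)
    (fun R => (mk_tail (d - 1) d hn hn1 Ωg hΩg0 hΩgi (g t) (mk_diff_x hg htI).continuous y M L R hL1
      (hgs t (Ioo_subset_Icc_self htI) y) (htail (g t) Ωg (hΩg' t ht) y (by linarith))).trans
        (hL0 L hLL).2) hI hJ
  -- the time derivative
  have hdt := mk_deriv_nonneg (fun s => f s x - g s y - ‖x - y‖ ^ 2 / (2 * ε) -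
      κ * Real.exp (B * s) * mkW x - 3 * η * s) 
      (deriv (fun s => f s x) t - deriv (fun s => g s y) t - 
        κ * (Real.exp (B * t) * B) * mkW x - 3 * η) t0 t ?_ hne ?_
  · have hBL : κ * Real.exp (B * t) * (d / (2 * ε) + 1 / 2) * (C * L) ≤
        κ * (Real.exp (B * t) * B) * mkW x := by
      have h1 : L ≤ (L0 + 2) * mkW x := by
        have : L0 * 1 ≤ L0 * mkW x := by gcongr
        linarith
      calc κ * Real.exp (B * t) * (d / (2 * ε) + 1 / 2) * (C * L)
          ≤ κ * Real.exp (B * t) * (d / (2 * ε) + 1 / 2) * (C * ((L0 + 2) * mkW x)) := by gcongr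
        _ = κ * (Real.exp (B * t) * ((d / (2 * ε) + 1 / 2) * C * (L0 + 2))) * mkW x := by ring
        _ = _ := by rw [← hB]
    linarith
  · have d1 := (mk_diff_t hf htI x).hasDerivAt
    have d2 := (mk_diff_t hg htI y).hasDerivAt
    have d3 : HasDerivAt (fun s : ℝ => Real.exp (B * s)) (Real.exp (B * t) * B) t := by
      have : HasDerivAt (fun s : ℝ => B * s) B t := by
        simpa using (hasDerivAt_id t).const_mul B
      exact this.exp
    have d4 := (d3.const_mul κ).mul_const (mkW x)
    have d5 : HasDerivAt (fun s : ℝ => 3 * η * s) (3 * η) t := by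
      simpa using (hasDerivAt_id t).const_mul (3 * η)
    exact (((d1.sub d2).sub_const _).sub d4).sub d5
  · intro s hs
    have := hmax s ⟨hs.1, hs.2.trans ht.2⟩ x y
    rw [hΦ] at this
    exact this

/-- **Theorem 1.2 / 7.2 of the paper (comparison principle).** Let `d = 2` or `3`, and let
`f`, `g` be a classical subsolution and a classical supersolution of the `d`-dimensional
Muskat equation on `[0,T]` with `‖∇f‖_{L∞}, ‖∇g‖_{L∞} < 1/√(2d−1)`. If `f(0,·) ≤ g(0,·)`,
then `f ≤ g` on `[0,T] × ℝ^{d−1}`. -/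
theorem muskat_comparison_principle (d : ℕ) (hd : d = 2 ∨ d = 3) (T : ℝ) (hT : 0 < T)
    (f g : ℝ → EuclideanSpace ℝ (Fin (d - 1)) → ℝ)
    (hf : IsClassicalMuskat d T (· ≤ ·) f)
    (hg : IsClassicalMuskat d T (fun a b => b ≤ a) g)
    (hfs : ∃ M : ℝ, M < 1 / Real.sqrt (2 * (d : ℝ) - 1) ∧
      ∀ t ∈ Icc 0 T, ∀ x, ‖gradient (f t) x‖ ≤ M)
    (hgs : ∃ M : ℝ, M < 1 / Real.sqrt (2 * (d : ℝ) - 1) ∧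
      ∀ t ∈ Icc 0 T, ∀ x, ‖gradient (g t) x‖ ≤ M)
    (h0 : ∀ x, f 0 x ≤ g 0 x) :
    ∀ t ∈ Icc 0 T, ∀ x, f t x ≤ g t x := by
  
  have hd2 : 2 ≤ d := by omega
  have hdr : (2 : ℝ) ≤ d := by exact_mod_cast hd2
  obtain ⟨Mf, hMf, hf'⟩ := hfs
  obtain ⟨Mg, hMg, hg'⟩ := hgs
  have hpos : 0 < 2 * (d : ℝ) - 1 := by linarith
  have hm : (2 * (d : ℝ) - 1) * (1 / Real.sqrt (2 * (d : ℝ) - 1)) ^ 2 ≤ 1 := by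
    rw [div_pow, Real.sq_sqrt hpos.le, one_pow, mul_one_div, div_self hpos.ne']
  have hM0 : 0 ≤ max Mf Mg :=
    (norm_nonneg (gradient (f 0) 0)).trans
      ((hf' 0 ⟨le_rfl, hT.le⟩ 0).trans (le_max_left _ _))
  have hinner : ∀ t ∈ Ioo 0 T, ∀ x, f t x ≤ g t x := fun t ht x =>
    mk_interior d hd2 T f g hf hg (max Mf Mg) _ (max_lt hMf hMg) hm hM0
      (fun t ht x => (hf' t ht x).trans (le_max_left _ _))
      (fun t ht x => (hg' t ht x).trans (le_max_right _ _)) h0 t ht x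
  intro t ht x
  rcases eq_or_lt_of_le ht.1 with h | h
  · rw [← h]; exact h0 x
  rcases eq_or_lt_of_le ht.2 with h' | h'
  · rw [h']
    refine le_of_tendsto_of_tendsto (hf.limit_T.tendsto_at x) (hg.limit_T.tendsto_at x) ?_
    have : ∀ᶠ s in 𝓝[<] T, s ∈ Ioo 0 T := Ioo_mem_nhdsLT hT
    filter_upwards [this] with s hs
    exact hinner s hs x
  · exact hinner t ⟨h, h'⟩ x
end
end

section
/- (Breakthrough lemma) Let f ∈ C([0,T]; C³₀(ℝ²)) (continuous in time with values in C³ functions decaying, together with their derivatives up to order 3, at infinity), let t₀ ∈ (0,T), and let ω̄ : [0,∞) → [0,∞) be a Lipschitz modulus of continuity with ω̄(0) = 0, ω̄ concave, and ω̄''(0) = −∞ (i.e., (ω̄'(r) − ω̄'(0))/r → −∞ as r → 0⁺). Suppose |∇_x f(t₀,x) − ∇_x f(t₀,y)| < ω̄(|x−y|/t₀) for all x ≠ y ∈ ℝ². Then there exists ε₀ > 0 such that for all 0 < ε ≤ ε₀, |∇_x f(t₀+ε,x) − ∇_x f(t₀+ε,y)| < ω̄(|x−y|/(t₀+ε)) for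 all x ≠ y ∈ ℝ². -/
open MeasureTheory Filter Set
open scoped Topology

noncomputable section

lemma mb_omega_upper (ω ω' : ℝ → ℝ) (hω0 : ω 0 = 0)
    (hder : ∀ r ∈ Ici (0 : ℝ), HasDerivWithinAt ω (ω' r) (Ici 0) r)
    (hsecond : Tendsto (fun r => (ω' r - ω' 0) / r) (𝓝[>] (0 : ℝ)) atBot) (M : ℝ) :
    ∃ s > 0, ω s ≤ ω' 0 * s - M * s ^ 2 := by
  have h1 := hsecond.eventually (eventually_le_atBot (-(2 * M)))
  rw [eventually_nhdsWithin_iff, Metric.eventually_nhds_iff] at h1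
  obtain ⟨ρ, hρ, h1⟩ := h1
  refine ⟨ρ / 2, by positivity, ?_⟩
  have hd : ∀ x ∈ Ioo 0 (ρ / 2), HasDerivAt (fun r => ω r - ω' 0 * r + M * r ^ 2)
      (ω' x - ω' 0 + M * (2 * x)) x := by
    intro x hx
    have a := (hder x hx.1.le).hasDerivAt (Ici_mem_nhds hx.1)
    have b := (hasDerivAt_id x).const_mul (ω' 0)
    have c := ((hasDerivAt_id x).pow 2).const_mul M
    have d := (a.sub b).add c
    refine d.congr_deriv ?_
    simp
  have hc : ContinuousOn (fun r => ω r - ω' 0 * r + M * r ^ 2) (Icc 0 (ρ / 2)) := by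
    have : ContinuousOn ω (Icc 0 (ρ / 2)) := fun x hx =>
      ((hder x hx.1).continuousWithinAt).mono Icc_subset_Ici_self
    fun_prop
  obtain ⟨c, hc1, hc2⟩ := exists_hasDerivAt_eq_slope _ _ (half_pos hρ) hc hd
  have h2 := h1 (y := c) (by rw [Real.dist_eq, sub_zero, abs_of_pos hc1.1]; linarith [hc1.2]) hc1.1
  rw [div_le_iff₀ hc1.1] at h2
  have h3 : (ω (ρ / 2) - ω' 0 * (ρ / 2) + M * (ρ / 2) ^ 2 -
    (ω 0 - ω' 0 * 0 + M * 0 ^ 2)) / (ρ / 2 - 0) ≤ 0 := by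
    rw [← hc2]; linarith
  rw [sub_zero, div_le_iff₀ (half_pos hρ), hω0] at h3
  linarith

lemma mb_omega_lower (ω : ℝ → ℝ) (a b : ℝ) (hω0 : ω 0 = 0)
    (hder : HasDerivWithinAt ω b (Ici 0) 0) (hab : a < b) :
    ∃ s₀ > 0, ∀ s, 0 < s → s < s₀ → a * s < ω s := by
  have h := ((hasDerivWithinAt_iff_tendsto_slope' (by simp)).1 hder.Ioi_of_Ici).eventually (eventually_gt_nhds hab)
  rw [eventually_nhdsWithin_iff, Metric.eventually_nhds_iff] at h
  obtain ⟨ρ, hρ, h1⟩ := h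
  refine ⟨ρ, hρ, fun s hs hs' => ?_⟩
  have := h1 (y := s) (by rw [Real.dist_eq, sub_zero, abs_of_pos hs]; exact hs') hs
  rw [slope_def_field, hω0, sub_zero, sub_zero, lt_div_iff₀ hs] at this
  exact this

lemma mb_bdd {F : Type*} [NormedAddCommGroup F] (u : E2 → F) (hc : Continuous u)
    (h : Tendsto (fun x => ‖u x‖) (cocompact E2) (𝓝 0)) :
    (∃ x, ∀ y, ‖u y‖ ≤ ‖u x‖) := by
  by_cases h0 : ∀ x, ‖u x‖ = 0
  · exact ⟨0, fun y => by rw [h0, h0]⟩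
  push Not at h0
  obtain ⟨x0, hx0⟩ := h0
  have hp : 0 < ‖u x0‖ := lt_of_le_of_ne (norm_nonneg _) (Ne.symm hx0)
  exact hc.norm.exists_forall_ge' x0 ((h.eventually (eventually_lt_nhds hp)).mono fun _ => le_of_lt)

lemma mb_rolle (φ φ' : ℝ → ℝ) (hd : ∀ s, HasDerivAt φ (φ' s) s)
    (h : Tendsto φ (cocompact ℝ) (𝓝 0)) : ∃ s, φ' s = 0 := by
  by_cases h0 : ∀ s, φ s = 0
  · refine ⟨0, ?_⟩
    have : φ = fun _ => 0 := funext h0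
    have h1 := hd 0
    rw [this] at h1
    exact h1.unique (hasDerivAt_const _ _)
  push Not at h0
  obtain ⟨x0, hx0⟩ := h0
  have hc : Continuous φ := continuous_iff_continuousAt.2 fun s => (hd s).continuousAt
  have hp : 0 < φ x0 ^ 2 := by positivity
  have h2 : Tendsto (fun s => φ s ^ 2) (cocompact ℝ) (𝓝 0) := by simpa using h.pow 2
  obtain ⟨x, hx⟩ := (hc.pow 2).exists_forall_ge' x0
    ((h2.eventually (eventually_lt_nhds hp)).mono fun _ => le_of_lt)
  refine ⟨x, ?_⟩
  have hm : IsLocalMax (fun s => φ s ^ 2) x := Filter.Eventually.of_forall hx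
  have h3 := hm.hasDerivAt_eq_zero ((hd x).pow 2)
  have h4 : φ x ≠ 0 := by
    intro h5
    have := hx x0
    simp only [Pi.pow_apply, h5] at this
    nlinarith
  simpa [h4] using h3

lemma mb_grad_sub (f : E2 → ℝ) (x y : E2) :
    ‖gradient f x - gradient f y‖ = ‖fderiv ℝ f x - fderiv ℝ f y‖ := by
  unfold gradient
  rw [← map_sub, LinearIsometryEquiv.norm_map]

lemma mb_far_point (f : E2 → ℝ) (hf : Differentiable ℝ f)
    (h : Tendsto f (cocompact E2) (𝓝 0)) (x : E2) (hx : fderiv ℝ f x ≠ 0) :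
    ∃ y, y ≠ x ∧ ‖fderiv ℝ f x‖ ≤ ‖fderiv ℝ f x - fderiv ℝ f y‖ := by
  set v := gradient f x with hv
  have hin : ∀ z, fderiv ℝ f z v = inner ℝ (gradient f z) v := by
    intro z
    simp [gradient, InnerProductSpace.toDual_symm_apply]
  have hvn : ‖v‖ = ‖fderiv ℝ f x‖ := by
    rw [hv]; unfold gradient; rw [LinearIsometryEquiv.norm_map]
  have hv0 : v ≠ 0 := by
    intro h0; rw [h0, norm_zero] at hvn; exact hx (norm_eq_zero.1 hvn.symm)
  have hlim : Tendsto (fun s : ℝ => x + s • v) (cocompact ℝ) (cocompact E2) := by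
    rw [← Metric.cobounded_eq_cocompact, ← Metric.cobounded_eq_cocompact,
      ← tendsto_norm_atTop_iff_cobounded]
    have h1 : Tendsto (fun s : ℝ => ‖s‖ * ‖v‖ - ‖x‖) (Bornology.cobounded ℝ) atTop :=
      tendsto_atTop_add_const_right _ _
        (tendsto_norm_cobounded_atTop.atTop_mul_const (norm_pos_iff.2 hv0))
    refine tendsto_atTop_mono (fun s => ?_) h1
    have := norm_sub_le (x + s • v) x
    rw [add_sub_cancel_left, norm_smul] at this
    linarith
  obtain ⟨s, hs⟩ := mb_rolle (fun s => f (x + s • v)) (fun s => fderiv ℝ f (x + s • v) v)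
    (fun s => by
      have h1 : HasDerivAt (fun s : ℝ => x + s • v) v s := by
        simpa using ((hasDerivAt_id s).smul_const v).const_add x
      exact (hf (x + s • v)).hasFDerivAt.comp_hasDerivAt s h1) (h.comp hlim)
  rw [hin] at hs
  refine ⟨x + s • v, ?_, ?_⟩
  · intro h0
    rw [h0, ← hv, inner_self_eq_zero] at hs
    exact hv0 hs
  · rw [← mb_grad_sub, ← hvn, ← hv]
    have h2 := norm_sub_sq_real v (gradient f (x + s • v))
    rw [real_inner_comm, hs] at h2
    refine le_of_sq_le_sq ?_ (norm_nonneg _)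
    nlinarith [sq_nonneg ‖gradient f (x + s • v)‖]

lemma mb_K (G : E2 → (E2 →L[ℝ] ℝ)) (hG : Differentiable ℝ G) (C : ℝ)
    (hC : ∀ x y, ‖fderiv ℝ G x - fderiv ℝ G y‖ ≤ C * ‖x - y‖)
    (hC0 : 0 ≤ C) (t₀ : ℝ) (ht : 0 < t₀)
    (ω ω' : ℝ → ℝ) (hω0 : ω 0 = 0)
    (hder : ∀ r ∈ Ici (0 : ℝ), HasDerivWithinAt ω (ω' r) (Ici 0) r)
    (hsecond : Tendsto (fun r => (ω' r - ω' 0) / r) (𝓝[>] (0 : ℝ)) atBot)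
    (hmod : ∀ x y : E2, x ≠ y → ‖G x - G y‖ < ω (‖x - y‖ / t₀)) :
    ∃ K, 0 ≤ K ∧ K * t₀ < ω' 0 ∧ ∀ x, ‖fderiv ℝ G x‖ ≤ K := by
  obtain ⟨s, hs, hω⟩ := mb_omega_upper ω ω' hω0 hder hsecond (C * t₀ ^ 2 + 1)
  have key : ∀ x e : E2, ‖e‖ = 1 → ‖fderiv ℝ G x e‖ ≤ (ω' 0 - s) / t₀ := by
    intro x e he
    set h := s * t₀ with hh
    have hh0 : 0 < h := by positivity
    have hy : ‖(x + h • e) - x‖ = h := by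
      rw [add_sub_cancel_left, norm_smul, he, Real.norm_of_nonneg hh0.le, mul_one]
    have h1 := (convex_closedBall x h).norm_image_sub_le_of_norm_hasFDerivWithin_le'
      (f := G) (f' := fderiv ℝ G) (φ := fderiv ℝ G x) (C := C * h) (x := x) (y := x + h • e)
      (fun z _ => (hG z).hasFDerivAt.hasFDerivWithinAt)
      (fun z hz => (hC z x).trans (by
        gcongr
        simpa [dist_eq_norm] using hz))
      (Metric.mem_closedBall_self hh0.le) (by rw [Metric.mem_closedBall, dist_eq_norm, hy])
    have hne : x + h • e ≠ x := by
      intro h0; rw [h0, sub_self, norm_zero] at hy; linarith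
    have h2 := hmod _ _ hne
    rw [hy] at h1 h2
    rw [add_sub_cancel_left] at h1
    have h3 : ‖fderiv ℝ G x (h • e)‖ ≤ ‖G (x + h • e) - G x‖ +
      ‖G (x + h • e) - G x - fderiv ℝ G x (h • e)‖ := by
      have := norm_sub_le (G (x + h • e) - G x) (G (x + h • e) - G x - fderiv ℝ G x (h • e))
      rwa [sub_sub_cancel] at this
    rw [map_smul, norm_smul, Real.norm_of_nonneg hh0.le] at h3
    rw [map_smul] at h1
    have h4 : h / t₀ = s := by rw [hh]; field_simp
    rw [h4] at h2
    rw [le_div_iff₀ ht]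
    have h5 : h * ‖fderiv ℝ G x e‖ ≤ ω' 0 * s - s ^ 2 := by
      have : C * h * h = C * t₀ ^ 2 * s ^ 2 := by rw [hh]; ring
      linarith
    rw [hh] at h5
    have h6 : s * (‖fderiv ℝ G x e‖ * t₀) ≤ s * (ω' 0 - s) := by linarith
    exact le_of_mul_le_mul_left h6 hs
  have hK0 : 0 ≤ (ω' 0 - s) / t₀ :=
    (norm_nonneg _).trans (key 0 (EuclideanSpace.single 0 1) (by simp))
  refine ⟨(ω' 0 - s) / t₀, hK0, ?_, fun x => ?_⟩
  · rw [div_mul_cancel₀ _ ht.ne']; linarith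
  · exact ContinuousLinearMap.opNorm_le_of_unit_norm hK0 (key x)

lemma mb_near (G : ℝ → E2 → (E2 →L[ℝ] ℝ)) (hG : ∀ᶠ ε in 𝓝[>] (0 : ℝ), Differentiable ℝ (G ε))
    (t₀ : ℝ) (ht : 0 < t₀) (K b : ℝ) (hK0 : 0 ≤ K) (hK : K * t₀ < b)
    (hKb : ∀ x, ‖fderiv ℝ (G 0) x‖ ≤ K)
    (hu : ∀ η > 0, ∀ᶠ ε in 𝓝[>] (0 : ℝ), ∀ x, ‖fderiv ℝ (G ε) x - fderiv ℝ (G 0) x‖ ≤ η)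
    (ω : ℝ → ℝ) (hω0 : ω 0 = 0) (hder : HasDerivWithinAt ω b (Ici 0) 0) :
    ∃ δ > 0, ∀ᶠ ε in 𝓝[>] (0 : ℝ), ∀ x y : E2, x ≠ y → ‖x - y‖ < δ →
      ‖G ε x - G ε y‖ < ω (‖x - y‖ / (t₀ + ε)) := by
  obtain ⟨a, ha1, ha2⟩ := exists_between hK
  obtain ⟨s₀, hs₀, hlow⟩ := mb_omega_lower ω a b hω0 hder ha2
  obtain ⟨K', hK1, hK2⟩ := exists_between ((lt_div_iff₀ ht).2 ha1)
  rw [lt_div_iff₀ ht] at hK2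
  refine ⟨s₀ * t₀, by positivity, ?_⟩
  have h1 : ∀ᶠ ε in 𝓝[>] (0 : ℝ), K' * (t₀ + ε) < a := by
    have : Tendsto (fun ε : ℝ => K' * (t₀ + ε)) (𝓝[>] 0) (𝓝 (K' * (t₀ + 0))) :=
      (Continuous.tendsto (by fun_prop) 0).mono_left nhdsWithin_le_nhds
    rw [add_zero] at this
    exact this.eventually (eventually_lt_nhds hK2)
  filter_upwards [hG, h1, hu (K' - K) (by linarith), self_mem_nhdsWithin] with ε hd h1 h2 hε x y hxy hr
  have hε : 0 < ε := hε
  have hbd : ∀ z, ‖fderiv ℝ (G ε) z‖ ≤ K' := by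
    intro z
    have := norm_sub_norm_le (fderiv ℝ (G ε) z) (fderiv ℝ (G 0) z)
    linarith [h2 z, hKb z]
  have h3 := convex_univ.norm_image_sub_le_of_norm_fderiv_le (𝕜 := ℝ) (f := G ε)
    (fun z _ => hd z) (fun z _ => hbd z) (mem_univ y) (mem_univ x)
  refine h3.trans_lt ?_
  have hr0 : 0 < ‖x - y‖ := norm_pos_iff.2 (sub_ne_zero.2 hxy)
  have ht' : 0 < t₀ + ε := by positivity
  refine lt_trans ?_ (hlow (‖x - y‖ / (t₀ + ε)) (by positivity) ?_)
  · rw [← mul_div_assoc, lt_div_iff₀ ht']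
    nlinarith
  · rw [div_lt_iff₀ ht']
    nlinarith

lemma mb_far (G : ℝ → E2 → (E2 →L[ℝ] ℝ)) (t₀ : ℝ) (ht : 0 < t₀)
    (hz : Tendsto (fun x => ‖G 0 x‖) (cocompact E2) (𝓝 0))
    (hu : ∀ η > 0, ∀ᶠ ε in 𝓝[>] (0 : ℝ), ∀ x, ‖G ε x - G 0 x‖ ≤ η)
    (ω : ℝ → ℝ) (hmono : MonotoneOn ω (Ici 0)) (A R : ℝ) (hR : 0 < R) (hA : ∀ x, ‖G 0 x‖ ≤ A)
    (hAR : A < ω (R / t₀)) :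
    ∃ R₁ > 0, ∀ᶠ ε in 𝓝[>] (0 : ℝ), ∀ x y : E2, R₁ ≤ ‖x - y‖ →
      ‖G ε x - G ε y‖ < ω (‖x - y‖ / (t₀ + ε)) := by
  set c := (ω (R / t₀) - A) / 4 with hc
  have hc0 : 0 < c := by rw [hc]; linarith
  have h1 := hz.eventually (eventually_lt_nhds hc0)
  rw [← Metric.cobounded_eq_cocompact, ← comap_norm_atTop, eventually_comap,
    eventually_atTop] at h1
  obtain ⟨ρ, h1⟩ := h1
  refine ⟨max (2 * R) (2 * ρ), by positivity, ?_⟩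
  filter_upwards [hu c hc0, self_mem_nhdsWithin, nhdsWithin_le_nhds (eventually_lt_nhds ht)]
    with ε h2 hε hε' x y hr
  have hε : 0 < ε := hε
  have hr1 := (le_max_left _ _).trans hr
  have hr2 := (le_max_right _ _).trans hr
  have h3 : ‖G 0 x‖ + ‖G 0 y‖ < A + c := by
    by_cases hx : ρ ≤ ‖x‖
    · linarith [h1 _ hx x rfl, hA y]
    · have : ρ ≤ ‖y‖ := by linarith [norm_sub_le x y]
      linarith [h1 _ this y rfl, hA x]
  have h4 : ‖G ε x - G ε y‖ ≤ ‖G ε x - G 0 x‖ + ‖G ε y - G 0 y‖ + (‖G 0 x‖ + ‖G 0 y‖) := by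
    have e : G ε x - G ε y = (G ε x - G 0 x) - (G ε y - G 0 y) + (G 0 x - G 0 y) := by abel
    rw [e]
    refine (norm_add_le _ _).trans (add_le_add (norm_sub_le _ _) (norm_sub_le _ _))
  have h5 : ω (R / t₀) ≤ ω (‖x - y‖ / (t₀ + ε)) := by
    have hp : 0 < t₀ + ε := by linarith
    refine hmono (mem_Ici.2 (by positivity)) (mem_Ici.2 (by positivity)) ?_
    rw [div_le_div_iff₀ ht hp]
    nlinarith
  linarith [h2 x, h2 y]

lemma mb_mid (G : ℝ → E2 → (E2 →L[ℝ] ℝ)) (t₀ : ℝ) (ht : 0 < t₀) (hG : Continuous (G 0))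
    (hz : Tendsto (fun x => ‖G 0 x‖) (cocompact E2) (𝓝 0))
    (hu : ∀ η > 0, ∀ᶠ ε in 𝓝[>] (0 : ℝ), ∀ x, ‖G ε x - G 0 x‖ ≤ η)
    (ω : ℝ → ℝ) (hmono : MonotoneOn ω (Ici 0)) (L : NNReal) (hlip : LipschitzOnWith L ω (Ici 0))
    (hmod : ∀ x y : E2, x ≠ y → ‖G 0 x - G 0 y‖ < ω (‖x - y‖ / t₀))
    (δ R₁ : ℝ) (hδ : 0 < δ) (hR₁ : 0 < R₁) :
    ∀ᶠ ε in 𝓝[>] (0 : ℝ), ∀ x y : E2, δ ≤ ‖x - y‖ → ‖x - y‖ ≤ R₁ →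
      ‖G ε x - G ε y‖ < ω (‖x - y‖ / (t₀ + ε)) := by
  -- uniform gap at time zero
  have gap : ∃ c > 0, ∀ x y : E2, δ ≤ ‖x - y‖ → ‖x - y‖ ≤ R₁ →
      ‖G 0 x - G 0 y‖ + c ≤ ω (‖x - y‖ / t₀) := by
    have hw : 0 < ω (δ / t₀) := by
      have := hmod (EuclideanSpace.single 0 δ) 0 (by
        intro h
        have := congrArg norm h
        simp at this
        linarith)
      simp only [sub_zero, EuclideanSpace.norm_single, Real.norm_of_nonneg hδ.le] at this
      exact (norm_nonneg _).trans_lt this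
    have h1 := hz.eventually (eventually_lt_nhds (show 0 < ω (δ / t₀) / 4 by positivity))
    rw [← Metric.cobounded_eq_cocompact, ← comap_norm_atTop, eventually_comap,
      eventually_atTop] at h1
    obtain ⟨ρ, h1⟩ := h1
    set S : Set (E2 × E2) := (Metric.closedBall 0 (ρ + R₁) ×ˢ Metric.closedBall 0 (ρ + 2 * R₁)) ∩
      {p | δ ≤ ‖p.1 - p.2‖} with hS
    have hScomp : IsCompact S := by
      refine ((isCompact_closedBall _ _).prod (isCompact_closedBall _ _)).inter_right ?_
      exact isClosed_le continuous_const (by fun_prop)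
    have hwc : ContinuousOn (fun p : E2 × E2 => ω (‖p.1 - p.2‖ / t₀) - ‖G 0 p.1 - G 0 p.2‖) S := by
      refine ContinuousOn.sub ?_ (by fun_prop)
      refine hlip.continuousOn.comp (t := Ici 0) (by fun_prop) ?_
      intro p _
      exact mem_Ici.2 (by positivity)
    have hc1 : ∃ c > 0, ∀ p ∈ S, c ≤ ω (‖p.1 - p.2‖ / t₀) - ‖G 0 p.1 - G 0 p.2‖ := by
      rcases S.eq_empty_or_nonempty with he | hne
      · exact ⟨1, one_pos, fun p hp => by simp [he] at hp⟩
      · obtain ⟨p, hp, hmin⟩ := hScomp.exists_isMinOn hne hwc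
        refine ⟨_, ?_, fun q hq => hmin hq⟩
        have : p.1 ≠ p.2 := by
          intro h
          have := hp.2
          simp only [mem_setOf_eq, h, sub_self, norm_zero] at this
          linarith
        exact sub_pos.2 (hmod _ _ this)
    obtain ⟨c, hc0, hc⟩ := hc1
    refine ⟨min c (ω (δ / t₀) / 4), by positivity, fun x y h2 h3 => ?_⟩
    by_cases hx : ‖x‖ ≤ ρ + R₁
    · have hy : ‖y‖ ≤ ρ + 2 * R₁ := by
        have := norm_sub_le x (x - y)
        rw [sub_sub_cancel] at this
        linarith
      have := hc (x, y) ⟨⟨by simpa using hx, by simpa using hy⟩, h2⟩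
      simp only at this
      linarith [min_le_left c (ω (δ / t₀) / 4)]
    · have hy : ρ ≤ ‖y‖ := by
        have := norm_add_le (x - y) y
        rw [sub_add_cancel] at this
        linarith
      have hm : ω (δ / t₀) ≤ ω (‖x - y‖ / t₀) :=
        hmono (mem_Ici.2 (by positivity)) (mem_Ici.2 (by positivity)) (by gcongr)
      linarith [min_le_right c (ω (δ / t₀) / 4), norm_sub_le (G 0 x) (G 0 y), h1 _ hy y rfl,
        h1 _ (show ρ ≤ ‖x‖ by linarith) x rfl]
  obtain ⟨c, hc0, hc⟩ := gap
  have hlim : ∀ᶠ ε in 𝓝[>] (0 : ℝ), L * (R₁ / t₀ - R₁ / (t₀ + ε)) < c / 4 := by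
    have h : Tendsto (fun ε : ℝ => L * (R₁ / t₀ - R₁ / (t₀ + ε))) (𝓝[>] 0)
        (𝓝 (L * (R₁ / t₀ - R₁ / (t₀ + 0)))) := by
      refine Tendsto.mono_left ?_ nhdsWithin_le_nhds
      have : ContinuousAt (fun ε : ℝ => L * (R₁ / t₀ - R₁ / (t₀ + ε))) 0 := by
        have : t₀ + 0 ≠ 0 := by linarith
        fun_prop (disch := assumption)
      exact this
    rw [add_zero, sub_self, mul_zero] at h
    exact h.eventually (eventually_lt_nhds (by positivity))
  filter_upwards [hlim, hu (c / 4) (by positivity), self_mem_nhdsWithin] with ε h1 h2 hε x y hr1 hr2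
  have hε : 0 < ε := hε
  have hp : 0 < t₀ + ε := by linarith
  have h4 : ‖G ε x - G ε y‖ ≤ ‖G ε x - G 0 x‖ + ‖G ε y - G 0 y‖ + ‖G 0 x - G 0 y‖ := by
    have e : G ε x - G ε y = (G ε x - G 0 x) - (G ε y - G 0 y) + (G 0 x - G 0 y) := by abel
    rw [e]
    refine (norm_add_le _ _).trans (add_le_add (norm_sub_le _ _) le_rfl)
  have h5 := hlip.dist_le_mul (‖x - y‖ / t₀) (mem_Ici.2 (by positivity))
    (‖x - y‖ / (t₀ + ε)) (mem_Ici.2 (by positivity))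
  have hle : 0 ≤ 1 / t₀ - 1 / (t₀ + ε) := by
    rw [sub_nonneg]
    exact one_div_le_one_div_of_le ht (by linarith)
  have h6 : dist (‖x - y‖ / t₀) (‖x - y‖ / (t₀ + ε)) ≤ R₁ / t₀ - R₁ / (t₀ + ε) := by
    have e : ‖x - y‖ / t₀ - ‖x - y‖ / (t₀ + ε) = ‖x - y‖ * (1 / t₀ - 1 / (t₀ + ε)) := by ring
    have e' : R₁ / t₀ - R₁ / (t₀ + ε) = R₁ * (1 / t₀ - 1 / (t₀ + ε)) := by ring
    rw [Real.dist_eq, e, e', abs_of_nonneg (by positivity)]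
    gcongr
  have h7 := mul_le_mul_of_nonneg_left h6 L.2
  rw [Real.dist_eq] at h5
  have h8 := le_abs_self (ω (‖x - y‖ / t₀) - ω (‖x - y‖ / (t₀ + ε)))
  have h9 : ω (‖x - y‖ / t₀) - ω (‖x - y‖ / (t₀ + ε)) < c / 4 :=
    (h8.trans (h5.trans h7)).trans_lt h1
  linarith [hc x y hr1 hr2, h2 x, h2 y]

lemma mb_sub_fderiv (f g : E2 → ℝ) (hf : ContDiff ℝ 3 f) (hg : ContDiff ℝ 3 g) (x : E2) :
    ‖fderiv ℝ f x - fderiv ℝ g x‖ = ‖iteratedFDeriv ℝ 1 f x - iteratedFDeriv ℝ 1 g x‖ ∧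
    ‖fderiv ℝ (fderiv ℝ f) x - fderiv ℝ (fderiv ℝ g) x‖
      = ‖iteratedFDeriv ℝ 2 f x - iteratedFDeriv ℝ 2 g x‖ := by
  have h0 : ∀ z, fderiv ℝ (f - g) z = fderiv ℝ f z - fderiv ℝ g z := fun z =>
    fderiv_sub (hf.differentiable (by norm_num) z) (hg.differentiable (by norm_num) z)
  have h0' : fderiv ℝ (f - g) = fderiv ℝ f - fderiv ℝ g := funext h0
  have hf1 : Differentiable ℝ (fderiv ℝ f) :=
    (hf.fderiv_right (m := 1) (by norm_num)).differentiable (by norm_num)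
  have hg1 : Differentiable ℝ (fderiv ℝ g) :=
    (hg.fderiv_right (m := 1) (by norm_num)).differentiable (by norm_num)
  constructor
  · rw [← h0, ← iteratedFDeriv_sub_apply (hf.of_le (by norm_num)).contDiffAt
      (hg.of_le (by norm_num)).contDiffAt, norm_iteratedFDeriv_one]
  · rw [← fderiv_sub (hf1 x) (hg1 x), ← h0', ← iteratedFDeriv_sub_apply
      (hf.of_le (by norm_num)).contDiffAt (hg.of_le (by norm_num)).contDiffAt,
      ← norm_iteratedFDeriv_fderiv, norm_iteratedFDeriv_one]

/-- **The breakthrough lemma (Lemma 3.1 of the paper).** Let `f ∈ C([0,T]; C³₀(ℝ²))` and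
`t₀ ∈ (0,T)`. If `ω̄` is a Lipschitz, concave, nondecreasing modulus of continuity with
`ω̄(0) = 0` and `ω̄''(0) = -∞` (in the sense that `(ω̄'(r) - ω̄'(0))/r → -∞` as `r → 0⁺`),
and `|∇f(t₀,x) − ∇f(t₀,y)| < ω̄(|x−y|/t₀)` for all `x ≠ y`, then the same strict
inequality at time `t₀ + ε` (with `t₀ + ε` in place of `t₀`) holds for all sufficiently
small `ε > 0`. -/
theorem muskat_breakthrough (T t₀ : ℝ) (hT : 0 < T) (ht₀ : t₀ ∈ Ioo 0 T)
    (f : ℝ → E2 → ℝ)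
    (hC3 : ∀ t ∈ Icc 0 T, ContDiff ℝ 3 (f t))
    (hdecay : ∀ t ∈ Icc 0 T, ∀ i : ℕ, i ≤ 3 →
      Tendsto (fun x : E2 => ‖iteratedFDeriv ℝ i (f t) x‖) (cocompact E2) (𝓝 0))
    (htime : ∀ t₁ ∈ Icc 0 T, ∀ ε > (0 : ℝ), ∃ δ > (0 : ℝ), ∀ t ∈ Icc 0 T, |t - t₁| < δ →
      ∀ i : ℕ, i ≤ 3 → ∀ x : E2,
        ‖iteratedFDeriv ℝ i (f t) x - iteratedFDeriv ℝ i (f t₁) x‖ ≤ ε)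
    (ω ω' : ℝ → ℝ) (hω0 : ω 0 = 0) (hmono : MonotoneOn ω (Ici 0))
    (hnonneg : ∀ r, 0 ≤ r → 0 ≤ ω r) (hconc : ConcaveOn ℝ (Ici 0) ω)
    (L : NNReal) (hlip : LipschitzOnWith L ω (Ici 0))
    (hder : ∀ r ∈ Ici (0 : ℝ), HasDerivWithinAt ω (ω' r) (Ici 0) r)
    (hsecond : Tendsto (fun r => (ω' r - ω' 0) / r) (𝓝[>] (0 : ℝ)) atBot)
    (hmod : ∀ x y : E2, x ≠ y →
      ‖gradient (f t₀) x - gradient (f t₀) y‖ < ω (‖x - y‖ / t₀)) :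
    ∃ ε₀ > (0 : ℝ), t₀ + ε₀ < T ∧ ∀ ε : ℝ, 0 < ε → ε ≤ ε₀ →
      ∀ x y : E2, x ≠ y →
        ‖gradient (f (t₀ + ε)) x - gradient (f (t₀ + ε)) y‖ < ω (‖x - y‖ / (t₀ + ε)) := by
  obtain ⟨ht, htT⟩ := ht₀
  have hmem : t₀ ∈ Icc 0 T := ⟨ht.le, htT.le⟩
  have hC := hC3 t₀ hmem
  set G : ℝ → E2 → (E2 →L[ℝ] ℝ) := fun ε => fderiv ℝ (f (t₀ + ε)) with hGdef
  have hG0 : G 0 = fderiv ℝ (f t₀) := by simp [hGdef]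
  have hin : ∀ᶠ ε in 𝓝[>] (0 : ℝ), t₀ + ε ∈ Icc 0 T := by
    filter_upwards [self_mem_nhdsWithin,
      nhdsWithin_le_nhds (eventually_lt_nhds (sub_pos.2 htT))] with ε h1 h2
    have h1 : 0 < ε := h1
    exact ⟨by linarith, by linarith⟩
  have hu : ∀ η > 0, ∀ᶠ ε in 𝓝[>] (0 : ℝ), ∀ x, ‖G ε x - G 0 x‖ ≤ η ∧
      ‖fderiv ℝ (G ε) x - fderiv ℝ (G 0) x‖ ≤ η := by
    intro η hη
    obtain ⟨δ, hδ, h⟩ := htime t₀ hmem η hη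
    filter_upwards [hin, self_mem_nhdsWithin,
      nhdsWithin_le_nhds (eventually_lt_nhds hδ)] with ε h1 h2 h3 x
    have h2 : 0 < ε := h2
    have h4 := h (t₀ + ε) h1 (by rwa [add_sub_cancel_left, abs_of_pos h2])
    obtain ⟨e1, e2⟩ := mb_sub_fderiv (f (t₀ + ε)) (f t₀) (hC3 _ h1) hC x
    rw [hG0]
    exact ⟨e1.trans_le (h4 1 (by norm_num) x), e2.trans_le (h4 2 (by norm_num) x)⟩
  have hdiff : ∀ t ∈ Icc 0 T, Differentiable ℝ (fderiv ℝ (f t)) := fun t h =>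
    ((hC3 t h).fderiv_right (m := 1) (by norm_num)).differentiable (by norm_num)
  have hcont : Continuous (fderiv ℝ (f t₀)) := (hdiff t₀ hmem).continuous
  have hz : Tendsto (fun x => ‖fderiv ℝ (f t₀) x‖) (cocompact E2) (𝓝 0) := by
    have := hdecay t₀ hmem 1 (by norm_num)
    simpa only [norm_iteratedFDeriv_one] using this
  have hmod' : ∀ x y : E2, x ≠ y →
      ‖fderiv ℝ (f t₀) x - fderiv ℝ (f t₀) y‖ < ω (‖x - y‖ / t₀) := by
    intro x y hxy
    rw [← mb_grad_sub]
    exact hmod x y hxy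
  -- the Lipschitz bound for the second derivative
  obtain ⟨C, hC0, hCb⟩ : ∃ C : ℝ, 0 ≤ C ∧ ∀ x y,
      ‖fderiv ℝ (fderiv ℝ (f t₀)) x - fderiv ℝ (fderiv ℝ (f t₀)) y‖ ≤ C * ‖x - y‖ := by
    have hc3 : Continuous (iteratedFDeriv ℝ 3 (f t₀)) :=
      hC.continuous_iteratedFDeriv (by norm_num)
    obtain ⟨x₀, hx₀⟩ := mb_bdd _ hc3 (hdecay t₀ hmem 3 le_rfl)
    refine ⟨_, norm_nonneg (iteratedFDeriv ℝ 3 (f t₀) x₀), fun x y => ?_⟩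
    have hd2 : Differentiable ℝ (fderiv ℝ (fderiv ℝ (f t₀))) :=
      ((hC.fderiv_right (m := 2) (by norm_num)).fderiv_right
        (m := 1) (by norm_num)).differentiable (by norm_num)
    refine convex_univ.norm_image_sub_le_of_norm_fderiv_le (𝕜 := ℝ)
      (f := fderiv ℝ (fderiv ℝ (f t₀))) (fun z _ => hd2 z) (fun z _ => ?_) (mem_univ y) (mem_univ x)
    rw [← norm_iteratedFDeriv_one, norm_iteratedFDeriv_fderiv, norm_iteratedFDeriv_fderiv]
    exact hx₀ z
  obtain ⟨K, hK0, hK1, hK2⟩ := mb_K (fderiv ℝ (f t₀)) (hdiff t₀ hmem) C hCb hC0 t₀ ht ω ω' hω0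
    hder hsecond hmod'
  obtain ⟨δ, hδ, hnear⟩ := mb_near G (hin.mono fun ε h => hdiff _ h) t₀ ht K (ω' 0) hK0 hK1
    (by rw [hG0]; exact hK2) (fun η hη => (hu η hη).mono fun ε h x => (h x).2) ω hω0
    (hder 0 (mem_Ici.2 le_rfl))
  obtain ⟨A, R, hR, hA, hAR⟩ : ∃ A R : ℝ, 0 < R ∧ (∀ x, ‖fderiv ℝ (f t₀) x‖ ≤ A) ∧
      A < ω (R / t₀) := by
    obtain ⟨x, hx⟩ := mb_bdd _ hcont hz
    by_cases h0 : fderiv ℝ (f t₀) x = 0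
    · refine ⟨0, 1, one_pos, by simpa [h0] using hx, ?_⟩
      have := hmod' (EuclideanSpace.single 0 1) 0 (by
        intro h
        have := congrArg norm h
        simp at this)
      simp only [sub_zero, EuclideanSpace.norm_single, norm_one] at this
      exact (norm_nonneg _).trans_lt this
    · have hf0 : Tendsto (f t₀) (cocompact E2) (𝓝 0) := by
        have := hdecay t₀ hmem 0 (by norm_num)
        simp only [norm_iteratedFDeriv_zero] at this
        exact tendsto_zero_iff_norm_tendsto_zero.2 this
      obtain ⟨y, hyx, hy⟩ := mb_far_point (f t₀) (hC.differentiable (by norm_num)) hf0 x h0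
      exact ⟨_, ‖x - y‖, norm_pos_iff.2 (sub_ne_zero.2 hyx.symm), hx,
        hy.trans_lt (hmod' x y hyx.symm)⟩
  have hu1 : ∀ η > 0, ∀ᶠ ε in 𝓝[>] (0 : ℝ), ∀ x, ‖G ε x - G 0 x‖ ≤ η :=
    fun η hη => (hu η hη).mono fun ε h x => (h x).1
  obtain ⟨R₁, hR₁, hfar⟩ := mb_far G t₀ ht (by rw [hG0]; exact hz) hu1 ω hmono A R hR
    (by rw [hG0]; exact hA) hAR
  have hmid := mb_mid G t₀ ht (by rw [hG0]; exact hcont) (by rw [hG0]; exact hz) hu1 ω hmono L hlip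
    (by rw [hG0]; exact hmod') δ R₁ hδ hR₁
  have hall := hnear.and (hfar.and hmid)
  rw [eventually_nhdsWithin_iff, Metric.eventually_nhds_iff] at hall
  obtain ⟨ρ, hρ, hall⟩ := hall
  refine ⟨min (ρ / 2) ((T - t₀) / 2), lt_min (by linarith) (by linarith), ?_, ?_⟩
  · linarith [min_le_right (ρ / 2) ((T - t₀) / 2)]
  intro ε hε hε' x y hxy
  obtain ⟨h1, h2, h3⟩ := hall (y := ε) (by
    rw [Real.dist_eq, sub_zero, abs_of_pos hε]
    linarith [min_le_left (ρ / 2) ((T - t₀) / 2)]) hε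
  rw [mb_grad_sub]
  rcases lt_or_ge ‖x - y‖ δ with h | h
  · exact h1 x y hxy h
  rcases le_total R₁ ‖x - y‖ with h' | h'
  · exact h2 x y h'
  · exact h3 x y h h'
end
end
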